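/- arXiv:2407.09903 — 2 statements merged into one kernel-verified Lean document; each statement's English description precedes it below -/
import Mathlib

section
/- Let γ ≥ -1/2 and n ≥ 0. (i) If P is a real polynomial in two variables of total degree ≤ n such that ∫_{[-1,1]²} P(y₁+y₂, y₁y₂) g(y₁+y₂, y₁y₂) w(y₁)w(y₂) (1+y₁)(1+y₂) |y₁−y₂|^{2γ+1} dy₁dy₂ = 0 for every real polynomial g of total degree ≤ n−1, then Q(x₁,x₂) := (x₁+x₂)·P(2x₁x₂, x₁²+x₂²−1), of total degree ≤ 2n+1, satisfies ∫_{[-1,1]²} Q·h·W_γ dx₁dx₂ = 0 for every real polynomial h in two variables of total degree ≤ 2n. (ii) If P is a real polynomial of total degree ≤ n such that ∫_{[-1,1]²} P(y₁+y₂, y₁y₂) g(y₁+y₂, y₁y₂) w(y₁)w(y₂) (1−y₁)(1−y₂) |y₁−y₂|^{2γ+1} dy₁dy₂ = 0 for every real polynomial g of total degree ≤ n−1, then Q(x₁,x₂) := (x₁−x₂)·P(2x₁x₂, x₁²+x₂²−1) satisfies ∫_{[-1,1]²} Q·h·W_γ dx₁dx₂ = 0 for every real polynomial h in two variables of total degree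 ≤ 2n. -/
open MeasureTheory Set

noncomputable section

/-- The weight `W_γ` on the square `[-1,1]²`, with `θᵢ = arccos xᵢ`. -/
def Wsq (w : ℝ → ℝ) (γ : ℝ) (x : ℝ × ℝ) : ℝ :=
  w (Real.cos (Real.arccos x.1 - Real.arccos x.2)) *
  w (Real.cos (Real.arccos x.1 + Real.arccos x.2)) *
  (1 - x.1 ^ 2) ^ γ * (1 - x.2 ^ 2) ^ γ * |x.1 ^ 2 - x.2 ^ 2|

/-- The quotient of `x ^ (2m+1) + ε y ^ (2m+1)` by `x + ε y`, for `ε = ±1`, is a polynomial of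
degree at most `m` in `2xy` and `x² + y² - 1`. -/
lemma exists_quotient_odd_pow_add {ε : ℝ} (hε : ε ^ 2 = 1) (m : ℕ) :
    ∃ g : MvPolynomial (Fin 2) ℝ, g.totalDegree ≤ m ∧ ∀ x y : ℝ,
      x ^ (2 * m + 1) + ε * y ^ (2 * m + 1) =
        (x + ε * y) * MvPolynomial.eval ![2 * x * y, x ^ 2 + y ^ 2 - 1] g := by
  have hX1 : (MvPolynomial.X 1 + MvPolynomial.C 1 : MvPolynomial (Fin 2) ℝ).totalDegree ≤ 1 :=
    (MvPolynomial.totalDegree_add _ _).trans (by simp)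
  induction m using Nat.twoStepInduction with
  | zero => exact ⟨1, by simp, fun x y => by simp⟩
  | one =>
    refine ⟨(MvPolynomial.X 1 + MvPolynomial.C 1) +
      MvPolynomial.C (-ε / 2) * MvPolynomial.X 0, ?_, fun x y => ?_⟩
    · refine (MvPolynomial.totalDegree_add _ _).trans (max_le hX1 ?_)
      exact (MvPolynomial.totalDegree_mul _ _).trans (by simp)
    · simp only [map_add, map_mul, MvPolynomial.eval_X, MvPolynomial.eval_C,
        Matrix.cons_val_one, Matrix.cons_val_zero]
      linear_combination (x * y ^ 2) * hε
  | more m ih₁ ih₂ =>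
    obtain ⟨g₁, hg₁, h₁⟩ := ih₁
    obtain ⟨g₂, hg₂, h₂⟩ := ih₂
    refine ⟨(MvPolynomial.X 1 + MvPolynomial.C 1) * g₂ +
      MvPolynomial.C (-1 / 4) * (MvPolynomial.X 0 ^ 2 * g₁), ?_, fun x y => ?_⟩
    · refine (MvPolynomial.totalDegree_add _ _).trans (max_le ?_ ?_)
      · exact (MvPolynomial.totalDegree_mul _ _).trans (by omega)
      · refine (MvPolynomial.totalDegree_mul _ _).trans ?_
        have := MvPolynomial.totalDegree_mul (MvPolynomial.X 0 ^ 2) g₁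
        rw [MvPolynomial.totalDegree_X_pow] at this
        rw [MvPolynomial.totalDegree_C]
        omega
    · simp only [map_add, map_mul, map_pow, MvPolynomial.eval_X, MvPolynomial.eval_C,
        Matrix.cons_val_one, Matrix.cons_val_zero]
      linear_combination (x ^ 2 + y ^ 2) * h₂ x y - x ^ 2 * y ^ 2 * h₁ x y

lemma exists_quotient_monomial_of_le {ε : ℝ} (hε : ε ^ 2 = 1) {i j n : ℕ} (hji : j ≤ i)
    (hij : i + j ≤ 2 * n) (hodd : Odd (i + j)) :
    ∃ g : MvPolynomial (Fin 2) ℝ, g.totalDegree ≤ n - 1 ∧ ∀ x y : ℝ,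
      x ^ i * y ^ j + ε * (y ^ i * x ^ j) =
        (x + ε * y) * MvPolynomial.eval ![2 * x * y, x ^ 2 + y ^ 2 - 1] g := by
  obtain ⟨m, rfl⟩ : ∃ m, i = j + (2 * m + 1) := by
    obtain ⟨k, hk⟩ := hodd
    exact ⟨k - j, by omega⟩
  obtain ⟨g, hg, h⟩ := exists_quotient_odd_pow_add hε m
  refine ⟨(MvPolynomial.C (1 / 2) * MvPolynomial.X 0) ^ j * g, ?_, fun x y => ?_⟩
  · have h₁ := MvPolynomial.totalDegree_mul
      ((MvPolynomial.C (1 / 2 : ℝ) * MvPolynomial.X 0 : MvPolynomial (Fin 2) ℝ) ^ j) g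
    have h₂ := MvPolynomial.totalDegree_pow
      (MvPolynomial.C (1 / 2 : ℝ) * MvPolynomial.X 0 : MvPolynomial (Fin 2) ℝ) j
    have h₃ : (MvPolynomial.C (1 / 2 : ℝ) * MvPolynomial.X 0 :
        MvPolynomial (Fin 2) ℝ).totalDegree ≤ 1 :=
      (MvPolynomial.totalDegree_mul _ _).trans (by simp)
    have h₄ := Nat.mul_le_mul_left j h₃
    omega
  · simp only [map_mul, map_pow, MvPolynomial.eval_X, MvPolynomial.eval_C, Matrix.cons_val_zero]
    rw [show (1 / 2 * (2 * x * y) : ℝ) = x * y by ring, mul_pow]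
    linear_combination x ^ j * y ^ j * h x y

lemma exists_quotient_monomial {ε : ℝ} (hε : ε ^ 2 = 1) {i j n : ℕ} (hij : i + j ≤ 2 * n) :
    ∃ g : MvPolynomial (Fin 2) ℝ, g.totalDegree ≤ n - 1 ∧ ∀ x y : ℝ,
      x ^ i * y ^ j + ε * (y ^ i * x ^ j) - ε * ((-y) ^ i * (-x) ^ j) - (-x) ^ i * (-y) ^ j =
        (x + ε * y) * MvPolynomial.eval ![2 * x * y, x ^ 2 + y ^ 2 - 1] g := by
  have hneg (u v : ℝ) : (-u) ^ i * (-v) ^ j = (-1) ^ (i + j) * (u ^ i * v ^ j) := by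
    rw [neg_pow, neg_pow v, pow_add]; ring
  rcases Nat.even_or_odd (i + j) with heven | hodd
  · refine ⟨0, by simp, fun x y => ?_⟩
    rw [hneg, hneg, heven.neg_one_pow, map_zero]
    ring
  · obtain ⟨g, hg, h⟩ : ∃ g : MvPolynomial (Fin 2) ℝ, g.totalDegree ≤ n - 1 ∧ ∀ x y : ℝ,
        x ^ i * y ^ j + ε * (y ^ i * x ^ j) =
          (x + ε * y) * MvPolynomial.eval ![2 * x * y, x ^ 2 + y ^ 2 - 1] g := by
      rcases le_total j i with hji | hji
      · exact exists_quotient_monomial_of_le hε hji hij hodd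
      · obtain ⟨g, hg, h⟩ := exists_quotient_monomial_of_le hε hji (by omega : j + i ≤ 2 * n)
          (by rwa [add_comm])
        refine ⟨MvPolynomial.C ε * g, (MvPolynomial.totalDegree_mul _ _).trans (by simpa using hg),
          fun x y => ?_⟩
        rw [map_mul, MvPolynomial.eval_C]
        linear_combination ε * h x y - x ^ i * y ^ j * hε
    refine ⟨MvPolynomial.C 2 * g, (MvPolynomial.totalDegree_mul _ _).trans (by simpa using hg),
      fun x y => ?_⟩
    rw [hneg, hneg, hodd.neg_one_pow, map_mul, MvPolynomial.eval_C]
    linear_combination 2 * h x y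

/-- The projection of a polynomial of degree at most `2n` onto the polynomials that are odd and
satisfy `f(y, x) = ε f(x, y)` is `x + ε y` times a polynomial of degree at most `n - 1` in
`2xy` and `x² + y² - 1`. -/
lemma exists_quotient_symmetrization {ε : ℝ} (hε : ε ^ 2 = 1) {n : ℕ}
    (h : MvPolynomial (Fin 2) ℝ) (hh : h.totalDegree ≤ 2 * n) :
    ∃ g : MvPolynomial (Fin 2) ℝ, g.totalDegree ≤ n - 1 ∧ ∀ x y : ℝ,
      MvPolynomial.eval ![x, y] h + ε * MvPolynomial.eval ![y, x] h
        - ε * MvPolynomial.eval ![-y, -x] h - MvPolynomial.eval ![-x, -y] h =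
        (x + ε * y) * MvPolynomial.eval ![2 * x * y, x ^ 2 + y ^ 2 - 1] g := by
  have hd (d : Fin 2 →₀ ℕ) (hd : d ∈ h.support) : d 0 + d 1 ≤ 2 * n := by
    have := MvPolynomial.le_totalDegree hd
    rw [Finsupp.sum_fintype _ _ (by simp), Fin.sum_univ_two] at this
    omega
  choose! g hg hgeval using fun d hmem => exists_quotient_monomial hε (hd d hmem)
  refine ⟨∑ d ∈ h.support, MvPolynomial.C (h.coeff d) * g d, ?_, fun x y => ?_⟩
  · refine MvPolynomial.totalDegree_finsetSum_le fun d hmem => ?_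
    exact (MvPolynomial.totalDegree_mul _ _).trans (by simpa using hg d hmem)
  · simp only [MvPolynomial.eval_eq' _ h, Fin.prod_univ_two, Matrix.cons_val_zero,
      Matrix.cons_val_one, map_sum, map_mul, MvPolynomial.eval_C, Finset.mul_sum]
    simp only [← Finset.sum_add_distrib, ← Finset.sum_sub_distrib]
    refine Finset.sum_congr rfl fun d hmem => ?_
    linear_combination h.coeff d * hgeval d hmem x y

lemma totalDegree_bind₁_le {σ τ R : Type*} [Fintype σ] [CommSemiring R] (f : σ → MvPolynomial τ R)
    {k : ℕ} (hf : ∀ i, (f i).totalDegree ≤ k) (P : MvPolynomial σ R) :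
    (MvPolynomial.bind₁ f P).totalDegree ≤ k * P.totalDegree := by
  rw [MvPolynomial.bind₁, MvPolynomial.aeval_def, MvPolynomial.eval₂_eq']
  refine MvPolynomial.totalDegree_finsetSum_le fun d hd => ?_
  refine (MvPolynomial.totalDegree_mul _ _).trans ?_
  rw [MvPolynomial.algebraMap_eq, MvPolynomial.totalDegree_C, zero_add]
  refine (MvPolynomial.totalDegree_finsetProd _ _).trans ?_
  calc ∑ i, (f i ^ d i).totalDegree ≤ ∑ i, k * d i := Finset.sum_le_sum fun i _ =>
        (MvPolynomial.totalDegree_pow _ _).trans (by rw [mul_comm k]; gcongr; exact hf i)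
    _ = k * ∑ i, d i := by rw [Finset.mul_sum]
    _ ≤ k * P.totalDegree := by
        gcongr
        have := MvPolynomial.le_totalDegree hd
        rwa [Finsupp.sum_fintype _ _ (by simp)] at this

lemma exists_polynomial_lift (ε : ℝ) {n : ℕ} (P : MvPolynomial (Fin 2) ℝ)
    (hP : P.totalDegree ≤ n) :
    ∃ Q : MvPolynomial (Fin 2) ℝ, Q.totalDegree ≤ 2 * n + 1 ∧ ∀ x y : ℝ,
      MvPolynomial.eval ![x, y] Q =
        (x + ε * y) * MvPolynomial.eval ![2 * x * y, x ^ 2 + y ^ 2 - 1] P := by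
  let f : Fin 2 → MvPolynomial (Fin 2) ℝ :=
    ![MvPolynomial.C 2 * (MvPolynomial.X 0 * MvPolynomial.X 1),
      MvPolynomial.X 0 ^ 2 + MvPolynomial.X 1 ^ 2 - MvPolynomial.C 1]
  have hf (i : Fin 2) : (f i).totalDegree ≤ 2 := by
    fin_cases i
    · refine (MvPolynomial.totalDegree_mul _ _).trans ?_
      rw [MvPolynomial.totalDegree_C, zero_add]
      exact (MvPolynomial.totalDegree_mul _ _).trans (by simp)
    · refine (MvPolynomial.totalDegree_sub_C_le _ _).trans ?_
      exact (MvPolynomial.totalDegree_add _ _).trans (by simp)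
  refine ⟨(MvPolynomial.X 0 + MvPolynomial.C ε * MvPolynomial.X 1) * MvPolynomial.bind₁ f P,
    ?_, fun x y => ?_⟩
  · have h₁ : (MvPolynomial.X 0 + MvPolynomial.C ε * MvPolynomial.X 1 :
        MvPolynomial (Fin 2) ℝ).totalDegree ≤ 1 :=
      (MvPolynomial.totalDegree_add _ _).trans
        (max_le (by simp) ((MvPolynomial.totalDegree_mul _ _).trans (by simp)))
    have h₂ := totalDegree_bind₁_le f hf P
    exact (MvPolynomial.totalDegree_mul _ _).trans (by omega)
  · have hcomp : (fun i => MvPolynomial.eval ![x, y] (f i)) =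
        ![2 * x * y, x ^ 2 + y ^ 2 - 1] := by
      ext i
      fin_cases i <;> simp [f, mul_assoc]
    rw [map_mul, MvPolynomial.eval, MvPolynomial.eval₂Hom_bind₁]
    simp only [map_add, map_mul]
    change _ * MvPolynomial.eval (fun i => MvPolynomial.eval ![x, y] (f i)) P = _
    rw [hcomp]
    simp

lemma setIntegral_eq_of_ae_eq_union_preimage {α : Type*} [MeasurableSpace α] {μ : Measure α}
    {σ : α → α} (hσ : MeasurePreserving σ μ μ) (hinv : Function.Involutive σ) {S U : Set α}
    (hU : MeasurableSet U) (hdisj : Disjoint U (σ ⁻¹' U)) (hS : S =ᵐ[μ] (U ∪ σ ⁻¹' U : Set α))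
    {F : α → ℝ} (hF : IntegrableOn F U μ) (hFσ : IntegrableOn (F ∘ σ) U μ) :
    ∫ x in S, F x ∂μ = ∫ x in U, (F x + F (σ x)) ∂μ := by
  have hemb : MeasurableEmbedding σ :=
    (MeasurableEquiv.ofInvolutive σ hinv hσ.measurable).measurableEmbedding
  have hcomp : (F ∘ σ) ∘ σ = F := by ext x; simp [hinv x]
  have hF' : IntegrableOn F (σ ⁻¹' U) μ := by
    rwa [← hσ.integrableOn_comp_preimage hemb, hcomp] at hFσ
  rw [setIntegral_congr_set hS, setIntegral_union hdisj (hσ.measurable hU) hF hF',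
    integral_add (g := fun x => F (σ x)) hF hFσ,
    ← hσ.setIntegral_preimage_emb hemb (fun x => F (σ x)) U]
  simp only [hinv _]

/-- The open triangle `-1 < y < x < 1`. -/
def squareTriangle : Set (ℝ × ℝ) := {p | -1 < p.2 ∧ p.2 < p.1 ∧ p.1 < 1}

/-- The open triangle `|y| < x < 1`. -/
def rightTriangle : Set (ℝ × ℝ) := {p | -p.1 < p.2 ∧ p.2 < p.1 ∧ p.1 < 1}

lemma measurableSet_squareTriangle : MeasurableSet squareTriangle := by
  unfold squareTriangle
  measurability

lemma measurableSet_rightTriangle : MeasurableSet rightTriangle := by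
  unfold rightTriangle
  measurability

lemma ae_snd_ne_mul_fst (c : ℝ) : ∀ᵐ p : ℝ × ℝ, p.2 ≠ c * p.1 := by
  have hker : volume (LinearMap.ker (LinearMap.snd ℝ ℝ ℝ - c • LinearMap.fst ℝ ℝ ℝ) :
      Set (ℝ × ℝ)) = 0 := by
    apply Measure.addHaar_submodule
    rw [Ne, LinearMap.ker_eq_top]
    intro h
    have : (LinearMap.snd ℝ ℝ ℝ - c • LinearMap.fst ℝ ℝ ℝ) (0, 1) = 0 := by rw [h]; rfl
    simp at this
  rw [ae_iff]
  convert hker using 2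
  ext p
  simp [sub_eq_zero]

lemma measurePreserving_swap_real : MeasurePreserving (Prod.swap : ℝ × ℝ → ℝ × ℝ) :=
  Measure.measurePreserving_swap

lemma measurePreserving_neg_swap :
    MeasurePreserving (fun p : ℝ × ℝ => (-p.2, -p.1)) :=
  ((Measure.measurePreserving_neg (volume : Measure ℝ)).prod
    (Measure.measurePreserving_neg (volume : Measure ℝ))).comp Measure.measurePreserving_swap

lemma square_ae_eq_union_swap :
    (Icc (-1 : ℝ) 1 ×ˢ Icc (-1 : ℝ) 1 : Set (ℝ × ℝ)) =ᵐ[volume]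
      (squareTriangle ∪ Prod.swap ⁻¹' squareTriangle : Set (ℝ × ℝ)) := by
  have h : (Ioo (-1 : ℝ) 1 ×ˢ Ioo (-1 : ℝ) 1 : Set (ℝ × ℝ)) =ᵐ[volume]
      (Icc (-1 : ℝ) 1 ×ˢ Icc (-1 : ℝ) 1 : Set (ℝ × ℝ)) :=
    Measure.set_prod_ae_eq Ioo_ae_eq_Icc Ioo_ae_eq_Icc
  refine h.symm.trans ?_
  filter_upwards [ae_snd_ne_mul_fst 1] with p hp
  refine propext ?_
  change p ∈ Ioo (-1 : ℝ) 1 ×ˢ Ioo (-1 : ℝ) 1 ↔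
    p ∈ squareTriangle ∪ Prod.swap ⁻¹' squareTriangle
  simp only [squareTriangle, mem_prod, mem_Ioo, mem_union, mem_preimage, mem_ofPred_eq,
    Prod.fst_swap, Prod.snd_swap]
  rw [one_mul] at hp
  constructor
  · rintro ⟨⟨h₁, h₂⟩, h₃, h₄⟩
    rcases lt_or_gt_of_ne hp with h | h
    · exact Or.inl ⟨h₃, h, h₂⟩
    · exact Or.inr ⟨h₁, h, h₄⟩
  · rintro (⟨h₁, h₂, h₃⟩ | ⟨h₁, h₂, h₃⟩) <;>
      exact ⟨⟨by linarith, by linarith⟩, by linarith, by linarith⟩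

lemma disjoint_squareTriangle_swap : Disjoint squareTriangle (Prod.swap ⁻¹' squareTriangle) :=
  Set.disjoint_left.2 fun _ hp hp' => lt_asymm hp.2.1 hp'.2.1

lemma squareTriangle_ae_eq_union :
    squareTriangle =ᵐ[volume]
      (rightTriangle ∪ (fun p : ℝ × ℝ => (-p.2, -p.1)) ⁻¹' rightTriangle : Set (ℝ × ℝ)) := by
  filter_upwards [ae_snd_ne_mul_fst (-1)] with p hp
  refine propext ?_
  change p ∈ squareTriangle ↔
    p ∈ rightTriangle ∪ (fun p : ℝ × ℝ => (-p.2, -p.1)) ⁻¹' rightTriangle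
  simp only [squareTriangle, rightTriangle, mem_union, mem_preimage, mem_ofPred_eq]
  constructor
  · rintro ⟨h₁, h₂, h₃⟩
    rcases lt_or_gt_of_ne hp with h | h
    · exact Or.inr ⟨by linarith, by linarith, by linarith⟩
    · exact Or.inl ⟨by linarith, by linarith, by linarith⟩
  · rintro (⟨h₁, h₂, h₃⟩ | ⟨h₁, h₂, h₃⟩) <;> exact ⟨by linarith, by linarith, by linarith⟩

lemma disjoint_rightTriangle_neg_swap :
    Disjoint rightTriangle ((fun p : ℝ × ℝ => (-p.2, -p.1)) ⁻¹' rightTriangle) :=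
  Set.disjoint_left.2 fun p hp hp' => by
    have h₁ := hp.1
    have h₂ := hp'.1
    simp only at h₂
    linarith

/-- Folding the square along both of its diagonals. -/
lemma setIntegral_square_eq_rightTriangle {F : ℝ × ℝ → ℝ}
    (hF : IntegrableOn F (Icc (-1 : ℝ) 1 ×ˢ Icc (-1 : ℝ) 1)) :
    ∫ p in Icc (-1 : ℝ) 1 ×ˢ Icc (-1 : ℝ) 1, F p =
      ∫ p in rightTriangle, (F p + F (p.2, p.1) + (F (-p.2, -p.1) + F (-p.1, -p.2))) := by
  have hswap := measurePreserving_swap_real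
  have hswap_emb : MeasurableEmbedding (Prod.swap : ℝ × ℝ → ℝ × ℝ) :=
    MeasurableEquiv.prodComm.measurableEmbedding
  have hneg_inv : Function.Involutive (fun p : ℝ × ℝ => (-p.2, -p.1)) := fun p => by simp
  have hneg_emb : MeasurableEmbedding (fun p : ℝ × ℝ => (-p.2, -p.1)) :=
    (MeasurableEquiv.ofInvolutive _ hneg_inv
      measurePreserving_neg_swap.measurable).measurableEmbedding
  have hsub : squareTriangle ⊆ Icc (-1 : ℝ) 1 ×ˢ Icc (-1 : ℝ) 1 := fun p hp =>
    ⟨⟨by linarith [hp.1, hp.2.1], hp.2.2.le⟩, hp.1.le, by linarith [hp.2.1, hp.2.2]⟩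
  have hF₁ : IntegrableOn F squareTriangle := hF.mono_set hsub
  have hF₂ : IntegrableOn (F ∘ Prod.swap) squareTriangle := by
    have := (hswap.integrableOn_comp_preimage hswap_emb).2 hF
    refine this.mono_set fun p hp => ?_
    exact ⟨(hsub hp).2, (hsub hp).1⟩
  rw [setIntegral_eq_of_ae_eq_union_preimage hswap Prod.swap_swap measurableSet_squareTriangle
    disjoint_squareTriangle_swap square_ae_eq_union_swap hF₁ hF₂]
  have hadd : IntegrableOn (fun p => F p + F p.swap) squareTriangle := hF₁.add hF₂
  have hsub' : rightTriangle ⊆ squareTriangle := fun p hp =>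
    ⟨by linarith [hp.1, hp.2.2], hp.2.1, hp.2.2⟩
  rw [setIntegral_eq_of_ae_eq_union_preimage measurePreserving_neg_swap hneg_inv
    measurableSet_rightTriangle disjoint_rightTriangle_neg_swap squareTriangle_ae_eq_union
    (hadd.mono_set hsub')]
  · rfl
  · refine IntegrableOn.mono_set
      ((measurePreserving_neg_swap.integrableOn_comp_preimage hneg_emb).2 hadd) fun p hp => ?_
    simp only [mem_preimage, squareTriangle, mem_ofPred_eq]
    exact ⟨by linarith [hp.2.2], by linarith [hp.2.1], by linarith [hp.1, hp.2.2]⟩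

lemma setIntegral_squareTriangle_eq_zero {G : ℝ × ℝ → ℝ} (hG : ∀ p, G p.swap = G p)
    (h : ∫ p in Icc (-1 : ℝ) 1 ×ˢ Icc (-1 : ℝ) 1, G p = 0) :
    ∫ p in squareTriangle, G p = 0 := by
  by_cases hint : IntegrableOn G squareTriangle
  · have hcomp : G ∘ Prod.swap = G := funext hG
    rw [setIntegral_eq_of_ae_eq_union_preimage measurePreserving_swap_real Prod.swap_swap
      measurableSet_squareTriangle disjoint_squareTriangle_swap square_ae_eq_union_swap hint
      (by rwa [hcomp])] at h
    simp only [hG, ← two_mul] at h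
    rw [integral_const_mul] at h
    linarith
  · exact integral_undef hint

/-- In the coordinates `x = cos θ₁`, `y = cos θ₂`, the map
`(θ₁, θ₂) ↦ (cos (θ₁ - θ₂), cos (θ₁ + θ₂))`. -/
def cosSubAdd (p : ℝ × ℝ) : ℝ × ℝ :=
  (p.1 * p.2 + √(1 - p.1 ^ 2) * √(1 - p.2 ^ 2), p.1 * p.2 - √(1 - p.1 ^ 2) * √(1 - p.2 ^ 2))

lemma one_sub_sq_pos_of_mem_rightTriangle {p : ℝ × ℝ} (hp : p ∈ rightTriangle) :
    0 < 1 - p.1 ^ 2 ∧ 0 < 1 - p.2 ^ 2 := by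
  obtain ⟨h₁, h₂, h₃⟩ := hp
  constructor <;> nlinarith

lemma cosSubAdd_add (p : ℝ × ℝ) : (cosSubAdd p).1 + (cosSubAdd p).2 = 2 * p.1 * p.2 := by
  simp only [cosSubAdd]; ring

lemma cosSubAdd_mul {p : ℝ × ℝ} (h₁ : 0 ≤ 1 - p.1 ^ 2) (h₂ : 0 ≤ 1 - p.2 ^ 2) :
    (cosSubAdd p).1 * (cosSubAdd p).2 = p.1 ^ 2 + p.2 ^ 2 - 1 := by
  simp only [cosSubAdd]
  linear_combination (-√(1 - p.2 ^ 2) ^ 2) * Real.sq_sqrt h₁ - (1 - p.1 ^ 2) * Real.sq_sqrt h₂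

/-- The derivative of `cosSubAdd`. -/
def fderivCosSubAdd (p : ℝ × ℝ) : ℝ × ℝ →L[ℝ] ℝ × ℝ :=
  (Matrix.toLin (.finTwoProd ℝ) (.finTwoProd ℝ)
    !![p.2 - p.1 * √(1 - p.2 ^ 2) / √(1 - p.1 ^ 2), p.1 - p.2 * √(1 - p.1 ^ 2) / √(1 - p.2 ^ 2);
      p.2 + p.1 * √(1 - p.2 ^ 2) / √(1 - p.1 ^ 2),
      p.1 + p.2 * √(1 - p.1 ^ 2) / √(1 - p.2 ^ 2)]).toContinuousLinearMap

lemma hasDerivAt_sqrt_one_sub_sq {t : ℝ} (ht : 0 < 1 - t ^ 2) :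
    HasDerivAt (fun t => √(1 - t ^ 2)) (-t / √(1 - t ^ 2)) t := by
  have h := (((hasDerivAt_id t).pow 2).const_sub 1).sqrt ht.ne'
  convert! h using 1
  have := (Real.sqrt_pos.2 ht).ne'
  simp
  field_simp

lemma hasFDerivAt_cosSubAdd {p : ℝ × ℝ} (h₁ : 0 < 1 - p.1 ^ 2) (h₂ : 0 < 1 - p.2 ^ 2) :
    HasFDerivAt cosSubAdd (fderivCosSubAdd p) p := by
  have hx : HasFDerivAt (fun q : ℝ × ℝ => q.1) (ContinuousLinearMap.fst ℝ ℝ ℝ) p :=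
    hasFDerivAt_fst
  have hy : HasFDerivAt (fun q : ℝ × ℝ => q.2) (ContinuousLinearMap.snd ℝ ℝ ℝ) p :=
    hasFDerivAt_snd
  have hm := hx.mul hy
  have hs := ((hasDerivAt_sqrt_one_sub_sq h₁).comp_hasFDerivAt p hx).mul
    ((hasDerivAt_sqrt_one_sub_sq h₂).comp_hasFDerivAt p hy)
  unfold fderivCosSubAdd
  rw [Matrix.toLin_finTwoProd_toContinuousLinearMap]
  convert! (hm.add hs).prodMk (hm.sub hs) using 2
  all_goals
    apply ContinuousLinearMap.ext
    intro v
    simp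
    ring

lemma det_fderivCosSubAdd {p : ℝ × ℝ} (h₁ : 0 < 1 - p.1 ^ 2) (h₂ : 0 < 1 - p.2 ^ 2) :
    (fderivCosSubAdd p).det =
      -(2 * (p.1 ^ 2 - p.2 ^ 2)) / (√(1 - p.1 ^ 2) * √(1 - p.2 ^ 2)) := by
  unfold fderivCosSubAdd
  simp only [LinearMap.det_toContinuousLinearMap, LinearMap.det_toLin, Matrix.det_fin_two_of]
  have e₁ := Real.sq_sqrt h₁.le
  have e₂ := Real.sq_sqrt h₂.le
  have n₁ := (Real.sqrt_pos.2 h₁).ne'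
  have n₂ := (Real.sqrt_pos.2 h₂).ne'
  field_simp
  linear_combination (2 * p.2 ^ 2) * e₁ - (2 * p.1 ^ 2) * e₂

lemma injOn_cosSubAdd : InjOn cosSubAdd rightTriangle := by
  intro p hp q hq hpq
  obtain ⟨p₁, p₂⟩ := one_sub_sq_pos_of_mem_rightTriangle hp
  obtain ⟨q₁, q₂⟩ := one_sub_sq_pos_of_mem_rightTriangle hq
  have hadd : 2 * p.1 * p.2 = 2 * q.1 * q.2 := by
    rw [← cosSubAdd_add, ← cosSubAdd_add, hpq]
  have hmul : p.1 ^ 2 + p.2 ^ 2 - 1 = q.1 ^ 2 + q.2 ^ 2 - 1 := by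
    rw [← cosSubAdd_mul p₁.le p₂.le, ← cosSubAdd_mul q₁.le q₂.le, hpq]
  have h₁ : p.1 + p.2 = q.1 + q.2 :=
    (pow_left_inj₀ (by linarith [hp.1]) (by linarith [hq.1]) two_ne_zero).1 (by linarith)
  have h₂ : p.1 - p.2 = q.1 - q.2 :=
    (pow_left_inj₀ (by linarith [hp.2.1]) (by linarith [hq.2.1]) two_ne_zero).1 (by linarith)
  exact Prod.ext (by linarith) (by linarith)

lemma image_cosSubAdd_rightTriangle : cosSubAdd '' rightTriangle = squareTriangle := by
  apply Subset.antisymm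
  · rintro _ ⟨p, hp, rfl⟩
    obtain ⟨p₁, p₂⟩ := one_sub_sq_pos_of_mem_rightTriangle hp
    have hadd := cosSubAdd_add p
    have hmul := cosSubAdd_mul p₁.le p₂.le
    have hlt : (cosSubAdd p).2 < (cosSubAdd p).1 := by
      have := mul_pos (Real.sqrt_pos.2 p₁) (Real.sqrt_pos.2 p₂)
      simp only [cosSubAdd]
      linarith
    have hplus : 0 < (1 + (cosSubAdd p).1) * (1 + (cosSubAdd p).2) := by
      have : 0 < p.1 + p.2 := by linarith [hp.1]
      calc 0 < (p.1 + p.2) ^ 2 := by positivity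
        _ = _ := by linarith
    have hminus : 0 < (1 - (cosSubAdd p).1) * (1 - (cosSubAdd p).2) := by
      have : 0 < p.1 - p.2 := by linarith [hp.2.1]
      calc 0 < (p.1 - p.2) ^ 2 := by positivity
        _ = _ := by linarith
    have hle : (cosSubAdd p).1 + (cosSubAdd p).2 < 2 := by nlinarith [hp.2.2]
    have hge : -2 < (cosSubAdd p).1 + (cosSubAdd p).2 := by nlinarith [hp.2.2]
    refine ⟨?_, hlt, ?_⟩
    · by_contra! h
      nlinarith
    · by_contra! h
      nlinarith
  · rintro ⟨a, b⟩ ⟨hb, hab, ha⟩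
    simp only at hb hab ha
    have hu : 0 < (1 + a) * (1 + b) := mul_pos (by linarith) (by linarith)
    have hv : 0 < (1 - a) * (1 - b) := mul_pos (by linarith) (by linarith)
    have eu := Real.sq_sqrt hu.le
    have ev := Real.sq_sqrt hv.le
    have pu := Real.sqrt_pos.2 hu
    have pv := Real.sqrt_pos.2 hv
    set u := √((1 + a) * (1 + b))
    set v := √((1 - a) * (1 - b))
    have hprod : (1 - ((u + v) / 2) ^ 2) * (1 - ((u - v) / 2) ^ 2) = ((a - b) / 2) ^ 2 := by
      have e₁ : ((u + v) / 2) ^ 2 + ((u - v) / 2) ^ 2 = 1 + a * b := by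
        linear_combination eu / 2 + ev / 2
      have e₂ : (u + v) / 2 * ((u - v) / 2) = (a + b) / 2 := by
        linear_combination eu / 4 - ev / 4
      linear_combination -e₁ + ((u + v) / 2 * ((u - v) / 2) + (a + b) / 2) * e₂
    have huv : u + v < 2 := by
      by_contra! h
      have h₁ : 1 - ((u + v) / 2) ^ 2 ≤ 0 := by nlinarith
      have h₂ : 0 < 1 - ((u - v) / 2) ^ 2 := by nlinarith
      have h₃ : 0 < ((a - b) / 2) ^ 2 := by
        have : 0 < a - b := by linarith
        positivity
      nlinarith
    refine ⟨((u + v) / 2, (u - v) / 2), ⟨?_, ?_, ?_⟩, ?_⟩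
    · simp only; linarith
    · simp only; linarith
    · simp only; linarith
    · have h₁ : 0 ≤ 1 - ((u + v) / 2) ^ 2 := by nlinarith
      simp only [cosSubAdd]
      rw [← Real.sqrt_mul h₁, hprod, Real.sqrt_sq (by linarith)]
      ext
      · simp only; linear_combination eu / 4 - ev / 4
      · simp only; linear_combination eu / 4 - ev / 4

lemma cosSubAdd_eq_cos (p : ℝ × ℝ) (h₁ : p.1 ∈ Icc (-1 : ℝ) 1) (h₂ : p.2 ∈ Icc (-1 : ℝ) 1) :
    cosSubAdd p = (Real.cos (Real.arccos p.1 - Real.arccos p.2),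
      Real.cos (Real.arccos p.1 + Real.arccos p.2)) := by
  rw [Real.cos_sub, Real.cos_add, Real.sin_arccos, Real.sin_arccos,
    Real.cos_arccos h₁.1 h₁.2, Real.cos_arccos h₂.1 h₂.2, cosSubAdd]

lemma Wsq_swap (w : ℝ → ℝ) (γ x y : ℝ) : Wsq w γ (y, x) = Wsq w γ (x, y) := by
  simp only [Wsq]
  rw [← Real.cos_neg (Real.arccos y - Real.arccos x), neg_sub, add_comm (Real.arccos y),
    abs_sub_comm]
  ring

lemma Wsq_neg (w : ℝ → ℝ) (γ x y : ℝ) : Wsq w γ (-x, -y) = Wsq w γ (x, y) := by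
  simp only [Wsq, Real.arccos_neg, neg_sq]
  rw [show Real.pi - Real.arccos x - (Real.pi - Real.arccos y) =
      -(Real.arccos x - Real.arccos y) by ring, Real.cos_neg,
    show Real.pi - Real.arccos x + (Real.pi - Real.arccos y) =
      2 * Real.pi - (Real.arccos x + Real.arccos y) by ring, Real.cos_two_pi_sub]

/-- The pull-back of `|y₁ - y₂| ^ (2γ+1) w(y₁) w(y₂) dy₁ dy₂` under `cosSubAdd` is a multiple of
the weight `W_γ`. -/
lemma abs_det_fderivCosSubAdd_mul (w : ℝ → ℝ) (γ : ℝ) {p : ℝ × ℝ} (hp : p ∈ rightTriangle) :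
    |(fderivCosSubAdd p).det| * (w (cosSubAdd p).1 * w (cosSubAdd p).2 *
      |(cosSubAdd p).1 - (cosSubAdd p).2| ^ (2 * γ + 1)) =
      2 * 2 ^ (2 * γ + 1) * Wsq w γ p := by
  obtain ⟨h₁, h₂⟩ := one_sub_sq_pos_of_mem_rightTriangle hp
  have s₁ := Real.sqrt_pos.2 h₁
  have s₂ := Real.sqrt_pos.2 h₂
  have hdiff : (cosSubAdd p).1 - (cosSubAdd p).2 = 2 * (√(1 - p.1 ^ 2) * √(1 - p.2 ^ 2)) := by
    simp only [cosSubAdd]; ring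
  have hsqrt {t : ℝ} (ht : 0 < t) : √t ^ (2 * γ + 1) = t ^ γ * √t := by
    rw [Real.rpow_add (Real.sqrt_pos.2 ht), Real.rpow_mul (Real.sqrt_nonneg t), Real.rpow_one,
      Real.rpow_two, Real.sq_sqrt ht.le]
  have hcos := cosSubAdd_eq_cos p ⟨by nlinarith, by nlinarith⟩ ⟨by nlinarith, by nlinarith⟩
  rw [hdiff, abs_of_pos (by positivity : 0 < 2 * (√(1 - p.1 ^ 2) * √(1 - p.2 ^ 2))),
    Real.mul_rpow zero_le_two (by positivity), Real.mul_rpow s₁.le s₂.le, hsqrt h₁, hsqrt h₂,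
    det_fderivCosSubAdd h₁ h₂, abs_div, abs_neg, abs_mul, abs_two, abs_of_pos (mul_pos s₁ s₂),
    Wsq, hcos]
  field_simp

/-- Orthogonality of `P` for the weight with factor `(1 + ε y₁)(1 + ε y₂)`, where `ε = ±1`, lifts to
orthogonality of `(x₁ + ε x₂) P(2x₁x₂, x₁² + x₂² - 1)` for the weight `W_γ`. -/
lemma exists_orthogonal_lift (w : ℝ → ℝ) (γ : ℝ) {ε : ℝ} (hε : ε ^ 2 = 1) {n : ℕ}
    (P : MvPolynomial (Fin 2) ℝ) (hP : P.totalDegree ≤ n)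
    (horth : ∀ g : MvPolynomial (Fin 2) ℝ, g.totalDegree ≤ n - 1 →
      (∫ y in (Icc (-1 : ℝ) 1) ×ˢ (Icc (-1 : ℝ) 1),
        MvPolynomial.eval ![y.1 + y.2, y.1 * y.2] P *
          MvPolynomial.eval ![y.1 + y.2, y.1 * y.2] g *
          (w y.1 * w y.2 * ((1 + ε * y.1) * (1 + ε * y.2) * |y.1 - y.2| ^ (2 * γ + 1)))) = 0) :
    ∃ Q : MvPolynomial (Fin 2) ℝ, Q.totalDegree ≤ 2 * n + 1 ∧
      (∀ x₁ x₂ : ℝ, MvPolynomial.eval ![x₁, x₂] Q =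
        (x₁ + ε * x₂) * MvPolynomial.eval ![2 * x₁ * x₂, x₁ ^ 2 + x₂ ^ 2 - 1] P) ∧
      ∀ h : MvPolynomial (Fin 2) ℝ, h.totalDegree ≤ 2 * n →
        (∫ x in (Icc (-1 : ℝ) 1) ×ˢ (Icc (-1 : ℝ) 1),
          MvPolynomial.eval ![x.1, x.2] Q * MvPolynomial.eval ![x.1, x.2] h * Wsq w γ x) = 0 := by
  obtain ⟨Q, hQdeg, hQ⟩ := exists_polynomial_lift ε P hP
  refine ⟨Q, hQdeg, hQ, fun h hh => ?_⟩
  by_cases hint : IntegrableOn (fun x : ℝ × ℝ =>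
      MvPolynomial.eval ![x.1, x.2] Q * MvPolynomial.eval ![x.1, x.2] h * Wsq w γ x)
      (Icc (-1 : ℝ) 1 ×ˢ Icc (-1 : ℝ) 1)
  swap
  · exact integral_undef hint
  obtain ⟨g, hg, hgh⟩ := exists_quotient_symmetrization hε h hh
  set G : ℝ × ℝ → ℝ := fun y => MvPolynomial.eval ![y.1 + y.2, y.1 * y.2] P *
    MvPolynomial.eval ![y.1 + y.2, y.1 * y.2] g *
    (w y.1 * w y.2 * ((1 + ε * y.1) * (1 + ε * y.2) * |y.1 - y.2| ^ (2 * γ + 1))) with hG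
  have hGswap (p : ℝ × ℝ) : G p.swap = G p := by
    simp only [hG, Prod.fst_swap, Prod.snd_swap, add_comm p.2, mul_comm p.2, abs_sub_comm p.2]
    ring
  have hGzero := setIntegral_squareTriangle_eq_zero hGswap (horth g hg)
  rw [← image_cosSubAdd_rightTriangle, integral_image_eq_integral_abs_det_fderiv_smul volume
    measurableSet_rightTriangle (fun p hp => (hasFDerivAt_cosSubAdd
      (one_sub_sq_pos_of_mem_rightTriangle hp).1
      (one_sub_sq_pos_of_mem_rightTriangle hp).2).hasFDerivWithinAt) injOn_cosSubAdd] at hGzero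
  rw [setIntegral_square_eq_rightTriangle hint]
  have hpos : (0 : ℝ) < 2 * 2 ^ (2 * γ + 1) := by positivity
  refine (mul_eq_zero.1 ?_).resolve_left hpos.ne'
  rw [← integral_const_mul, ← hGzero]
  refine setIntegral_congr_fun measurableSet_rightTriangle fun p hp => ?_
  obtain ⟨h₁, h₂⟩ := one_sub_sq_pos_of_mem_rightTriangle hp
  have hdet := abs_det_fderivCosSubAdd_mul w γ hp
  have hmul := cosSubAdd_mul h₁.le h₂.le
  have hadd := cosSubAdd_add p
  have hfactor : (1 + ε * (cosSubAdd p).1) * (1 + ε * (cosSubAdd p).2) =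
      (p.1 + ε * p.2) ^ 2 := by
    linear_combination ε * hadd + ε ^ 2 * hmul + (p.1 ^ 2 - 1) * hε
  have hgp := hgh p.1 p.2
  have hW₁ : Wsq w γ (p.2, p.1) = Wsq w γ p := Wsq_swap w γ p.1 p.2
  have hW₂ : Wsq w γ (-p.2, -p.1) = Wsq w γ p := (Wsq_neg w γ p.2 p.1).trans hW₁
  have hW₃ : Wsq w γ (-p.1, -p.2) = Wsq w γ p := Wsq_neg w γ p.1 p.2
  simp only [hG, smul_eq_mul, hadd, hmul, hfactor, hQ, hW₁, hW₂, hW₃]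
  rw [show 2 * p.2 * p.1 = 2 * p.1 * p.2 by ring, show 2 * -p.2 * -p.1 = 2 * p.1 * p.2 by ring,
    show 2 * -p.1 * -p.2 = 2 * p.1 * p.2 by ring, neg_sq, neg_sq, add_comm (p.2 ^ 2)]
  set A := MvPolynomial.eval ![2 * p.1 * p.2, p.1 ^ 2 + p.2 ^ 2 - 1] P
  set B := MvPolynomial.eval ![2 * p.1 * p.2, p.1 ^ 2 + p.2 ^ 2 - 1] g
  set c : ℝ := 2 * 2 ^ (2 * γ + 1)
  linear_combination (c * Wsq w γ p * A * (p.1 + ε * p.2)) * hgp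
    - (A * B * (p.1 + ε * p.2) ^ 2) * hdet
    - c * Wsq w γ p * A * p.2 * (MvPolynomial.eval ![p.2, p.1] h -
      MvPolynomial.eval ![-p.2, -p.1] h) * hε
theorem stmt11 (w : ℝ → ℝ)
    (hw_nonneg : ∀ t ∈ Icc (-1:ℝ) 1, 0 ≤ w t)
    (hw_int : IntegrableOn w (Icc (-1:ℝ) 1))
    (hw_ne : ¬ (w =ᵐ[volume.restrict (Icc (-1:ℝ) 1)] 0))
    (γ : ℝ) (hγ : -1/2 ≤ γ) (n : ℕ) :
    -- (i) the case of the weight with factor (1+y₁)(1+y₂)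
    (∀ P : MvPolynomial (Fin 2) ℝ, P.totalDegree ≤ n →
      (∀ g : MvPolynomial (Fin 2) ℝ, g.totalDegree ≤ n - 1 →
        (∫ y in (Icc (-1:ℝ) 1) ×ˢ (Icc (-1:ℝ) 1),
          MvPolynomial.eval ![y.1 + y.2, y.1 * y.2] P *
            MvPolynomial.eval ![y.1 + y.2, y.1 * y.2] g *
            (w y.1 * w y.2 * ((1 + y.1) * (1 + y.2) * |y.1 - y.2| ^ (2*γ+1)))) = 0) →
      ∃ Q : MvPolynomial (Fin 2) ℝ, Q.totalDegree ≤ 2*n + 1 ∧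
        (∀ x₁ x₂ : ℝ, MvPolynomial.eval ![x₁, x₂] Q =
          (x₁ + x₂) * MvPolynomial.eval ![2 * x₁ * x₂, x₁ ^ 2 + x₂ ^ 2 - 1] P) ∧
        (∀ h : MvPolynomial (Fin 2) ℝ, h.totalDegree ≤ 2*n →
          (∫ x in (Icc (-1:ℝ) 1) ×ˢ (Icc (-1:ℝ) 1),
            MvPolynomial.eval ![x.1, x.2] Q * MvPolynomial.eval ![x.1, x.2] h *
              Wsq w γ x) = 0)) ∧
    -- (ii) the case of the weight with factor (1−y₁)(1−y₂)
    (∀ P : MvPolynomial (Fin 2) ℝ, P.totalDegree ≤ n →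
      (∀ g : MvPolynomial (Fin 2) ℝ, g.totalDegree ≤ n - 1 →
        (∫ y in (Icc (-1:ℝ) 1) ×ˢ (Icc (-1:ℝ) 1),
          MvPolynomial.eval ![y.1 + y.2, y.1 * y.2] P *
            MvPolynomial.eval ![y.1 + y.2, y.1 * y.2] g *
            (w y.1 * w y.2 * ((1 - y.1) * (1 - y.2) * |y.1 - y.2| ^ (2*γ+1)))) = 0) →
      ∃ Q : MvPolynomial (Fin 2) ℝ, Q.totalDegree ≤ 2*n + 1 ∧
        (∀ x₁ x₂ : ℝ, MvPolynomial.eval ![x₁, x₂] Q =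
          (x₁ - x₂) * MvPolynomial.eval ![2 * x₁ * x₂, x₁ ^ 2 + x₂ ^ 2 - 1] P) ∧
        (∀ h : MvPolynomial (Fin 2) ℝ, h.totalDegree ≤ 2*n →
          (∫ x in (Icc (-1:ℝ) 1) ×ˢ (Icc (-1:ℝ) 1),
            MvPolynomial.eval ![x.1, x.2] Q * MvPolynomial.eval ![x.1, x.2] h *
              Wsq w γ x) = 0)) := by
  refine ⟨fun P hP horth => ?_, fun P hP horth => ?_⟩
  · simpa only [one_mul] using exists_orthogonal_lift w γ (one_pow 2) P hP
      (by simpa only [one_mul] using horth)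
  · simpa only [neg_one_mul, ← sub_eq_add_neg] using
      exists_orthogonal_lift w γ (neg_one_sq (R := ℝ)) P hP
        (by simpa only [neg_one_mul, ← sub_eq_add_neg] using horth)

end
end

section
/- Write the Gauss nodes as t_k = cos θ_k with θ_k ∈ (0,π), and set s_{j,k} = cos((θ_j−θ_k)/2) and τ_{j,k} = cos((θ_j+θ_k)/2). Then for every real polynomial f in two variables of total degree ≤ 4m−1, ∫_{[-1,1]²} f(x₁,x₂) W_{-1/2}(x₁,x₂) dx₁dx₂ = (1/2) Σ_{k=1}^{m} Σ'_{j=1}^{k} λ_j λ_k [ f(s_{j,k}, τ_{j,k}) + f(τ_{j,k}, s_{j,k}) + f(−s_{j,k}, −τ_{j,k}) + f(−τ_{j,k}, −s_{j,k}) ], where Σ' means that the terms with j = k are multiplied by 1/2. Moreover the nodes appearing on the right-hand side are 2m(m+1) distinct points, so this cubature rule of degree 4m−1 attains Möller's lower bound dim Π²_{2m-1} + m = 2m(m+1). -/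
open MeasureTheory Set

noncomputable section

/-- The weight `W_{-1/2}` on the square `[-1,1]²`, with `θᵢ = arccos xᵢ`. -/
def Wm (w : ℝ → ℝ) (x : ℝ × ℝ) : ℝ :=
  w (Real.cos (Real.arccos x.1 - Real.arccos x.2)) *
  w (Real.cos (Real.arccos x.1 + Real.arccos x.2)) *
  |x.1 ^ 2 - x.2 ^ 2| / (Real.sqrt (1 - x.1 ^ 2) * Real.sqrt (1 - x.2 ^ 2))


/-! ### Symmetric polynomials -/

/-- `P` is a symmetric polynomial in two variables of degree at most `n` in each of them. -/
def IsSymmLE (n : ℕ) (P : MvPolynomial (Fin 2) ℝ) : Prop :=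
  (∀ i, P.degreeOf i ≤ n) ∧ ∀ x y, MvPolynomial.eval ![x, y] P = MvPolynomial.eval ![y, x] P

namespace IsSymmLE

open MvPolynomial

lemma mono {n k : ℕ} {P : MvPolynomial (Fin 2) ℝ} (h : IsSymmLE n P) (hnk : n ≤ k) :
    IsSymmLE k P :=
  ⟨fun i => (h.1 i).trans hnk, h.2⟩

lemma mul {n k : ℕ} {P Q : MvPolynomial (Fin 2) ℝ} (hP : IsSymmLE n P) (hQ : IsSymmLE k Q) :
    IsSymmLE (n + k) (P * Q) :=
  ⟨fun i => (degreeOf_mul_le i P Q).trans (add_le_add (hP.1 i) (hQ.1 i)),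
    fun x y => by rw [map_mul, map_mul, hP.2, hQ.2]⟩

lemma add {n : ℕ} {P Q : MvPolynomial (Fin 2) ℝ} (hP : IsSymmLE n P) (hQ : IsSymmLE n Q) :
    IsSymmLE n (P + Q) :=
  ⟨fun i => (degreeOf_add_le i P Q).trans (max_le (hP.1 i) (hQ.1 i)),
    fun x y => by rw [map_add, map_add, hP.2, hQ.2]⟩

lemma const (c : ℝ) : IsSymmLE 0 (C c) :=
  ⟨fun i => by simp [degreeOf_C], fun x y => by simp⟩

lemma pow {n : ℕ} {P : MvPolynomial (Fin 2) ℝ} (hP : IsSymmLE n P) (k : ℕ) :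
    IsSymmLE (k * n) (P ^ k) :=
  ⟨fun i => (degreeOf_pow_le i P k).trans (Nat.mul_le_mul_left k (hP.1 i)),
    fun x y => by rw [map_pow, map_pow, hP.2]⟩

lemma sum {ι : Type*} {n : ℕ} (s : Finset ι) (P : ι → MvPolynomial (Fin 2) ℝ)
    (h : ∀ i ∈ s, IsSymmLE n (P i)) : IsSymmLE n (∑ i ∈ s, P i) :=
  ⟨fun i => (degreeOf_sum_le i s P).trans (Finset.sup_le fun j hj => (h j hj).1 i),
    fun x y => by
      rw [map_sum, map_sum]
      exact Finset.sum_congr rfl fun i hi => (h i hi).2 x y⟩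

lemma X_add_X : IsSymmLE 1 (X 0 + X 1) :=
  ⟨fun i => (degreeOf_add_le i _ _).trans (by fin_cases i <;> simp [degreeOf_X]),
    fun x y => by simp [add_comm]⟩

lemma X_mul_X : IsSymmLE 1 (X 0 * X 1) :=
  ⟨fun i => (degreeOf_mul_le i _ _).trans (by fin_cases i <;> simp [degreeOf_X]),
    fun x y => by simp [mul_comm]⟩

end IsSymmLE

open MvPolynomial in
lemma exists_isSymmLE_powerSum (c : ℕ) : ∃ P, IsSymmLE c P ∧ ∀ x₁ x₂ x y : ℝ,
    x + y = 2 * (x₁ * x₂) → x * y = x₁ ^ 2 + x₂ ^ 2 - 1 →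
      eval ![x, y] P = x₁ ^ (2 * c) + x₂ ^ (2 * c) := by
  have hsum : IsSymmLE 1 (X 0 * X 1 + C 1) :=
    IsSymmLE.X_mul_X.add ((IsSymmLE.const 1).mono zero_le_one)
  have hprod : IsSymmLE 2 (C (-1 / 4) * (X 0 + X 1) ^ 2) :=
    ((IsSymmLE.const _).mul (IsSymmLE.X_add_X.pow 2)).mono (by norm_num)
  induction c using Nat.twoStepInduction with
  | zero => exact ⟨C 2, IsSymmLE.const 2, fun x₁ x₂ x y _ _ => by norm_num⟩
  | one =>
    refine ⟨_, hsum, fun x₁ x₂ x y _ h => ?_⟩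
    simp [h]
  | more c ih₀ ih₁ =>
    obtain ⟨P, hP, hPe⟩ := ih₀
    obtain ⟨Q, hQ, hQe⟩ := ih₁
    refine ⟨_, ((hsum.mul hQ).mono (by omega)).add ((hprod.mul hP).mono (by omega)),
      fun x₁ x₂ x y h₁ h₂ => ?_⟩
    simp only [map_add, map_mul, map_pow, eval_C, eval_X, Matrix.cons_val_zero,
      Matrix.cons_val_one, hPe x₁ x₂ x y h₁ h₂, hQe x₁ x₂ x y h₁ h₂, h₁, h₂]
    ring

/-- The orbit sum of a function on the plane under the group generated by the reflections in the
two diagonals. -/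
def orbitSum (g : ℝ → ℝ → ℝ) (x y : ℝ) : ℝ := g x y + g y x + g (-x) (-y) + g (-y) (-x)

open MvPolynomial in
lemma exists_isSymmLE_monomial (a b : ℕ) : ∃ P, IsSymmLE ((a + b) / 2) P ∧ ∀ x₁ x₂ x y : ℝ,
    x + y = 2 * (x₁ * x₂) → x * y = x₁ ^ 2 + x₂ ^ 2 - 1 →
      eval ![x, y] P = orbitSum (fun u v => u ^ a * v ^ b) x₁ x₂ := by
  wlog hab : b ≤ a generalizing a b
  · obtain ⟨P, hP, hPe⟩ := this b a (by omega)
    refine ⟨P, by rwa [add_comm], fun x₁ x₂ x y h₁ h₂ => ?_⟩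
    rw [hPe x₁ x₂ x y h₁ h₂, orbitSum, orbitSum]
    ring
  obtain ⟨d, rfl⟩ := Nat.exists_eq_add_of_le hab
  obtain ⟨c, rfl | rfl⟩ := Nat.even_or_odd' d
  · obtain ⟨Q, hQ, hQe⟩ := exists_isSymmLE_powerSum c
    refine ⟨C 2 * (C (1 / 2) * (X 0 + X 1)) ^ b * Q,
      (((IsSymmLE.const _).mul (((IsSymmLE.const _).mul IsSymmLE.X_add_X).pow b)).mul hQ).mono
        (by omega), fun x₁ x₂ x y h₁ h₂ => ?_⟩
    simp only [map_add, map_mul, map_pow, eval_C, eval_X, Matrix.cons_val_zero,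
      Matrix.cons_val_one, hQe x₁ x₂ x y h₁ h₂, h₁, orbitSum]
    have hx : (-x₁) ^ (b + 2 * c) * (-x₂) ^ b = x₁ ^ (b + 2 * c) * x₂ ^ b := by
      rw [pow_add, pow_add, mul_right_comm, ← mul_pow, neg_mul_neg, pow_mul, pow_mul, neg_sq]
      ring
    have hy : (-x₂) ^ (b + 2 * c) * (-x₁) ^ b = x₂ ^ (b + 2 * c) * x₁ ^ b := by
      rw [pow_add, pow_add, mul_right_comm, ← mul_pow, neg_mul_neg, pow_mul, pow_mul, neg_sq]
      ring
    rw [hx, hy, ← mul_assoc (1 / 2 : ℝ)]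
    norm_num
    ring
  · refine ⟨C 0, (IsSymmLE.const 0).mono (Nat.zero_le _), fun x₁ x₂ x y _ _ => ?_⟩
    have hneg (u v : ℝ) : (-u) ^ (b + (2 * c + 1)) * (-v) ^ b =
        -(u ^ (b + (2 * c + 1)) * v ^ b) := by
      have : (-u) ^ (b + (2 * c + 1)) * (-v) ^ b = (-u * -v) ^ b * ((-u) ^ 2) ^ c * -u := by
        rw [mul_pow, ← pow_mul, pow_add, pow_succ]
        generalize (-u) ^ b = A, (-v) ^ b = B, (-u) ^ (2 * c) = D
        ring
      rw [this, neg_mul_neg, neg_sq]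
      ring
    simp only [eval_C, orbitSum, hneg]
    ring

open MvPolynomial in
lemma exists_isSymmLE_orbitSum (f : MvPolynomial (Fin 2) ℝ) {n : ℕ}
    (hf : f.totalDegree ≤ 2 * n + 1) : ∃ P, IsSymmLE n P ∧ ∀ x₁ x₂ x y : ℝ,
    x + y = 2 * (x₁ * x₂) → x * y = x₁ ^ 2 + x₂ ^ 2 - 1 →
      eval ![x, y] P = orbitSum (fun u v => eval ![u, v] f) x₁ x₂ := by
  choose P hP hPe using exists_isSymmLE_monomial
  refine ⟨∑ d ∈ f.support, C (f.coeff d) * P (d 0) (d 1), IsSymmLE.sum _ _ fun d hd =>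
    ((IsSymmLE.const _).mul (hP _ _)).mono ?_, fun x₁ x₂ x y h₁ h₂ => ?_⟩
  · have := (le_totalDegree hd).trans hf
    rw [Finsupp.sum_fintype _ _ fun _ => rfl, Fin.sum_univ_two] at this
    omega
  · simp only [map_sum, map_mul, eval_C, hPe _ _ x₁ x₂ x y h₁ h₂, orbitSum]
    simp only [eval_eq', Fin.prod_univ_two, Matrix.cons_val_zero, Matrix.cons_val_one,
      ← Finset.sum_add_distrib, mul_add]

/-! ### Folding integrals along measure-preserving maps -/

lemma integral_fold {α : Type*} [MeasurableSpace α] {μ : Measure α} (σ : α ≃ᵐ α)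
    (hσ : MeasurePreserving σ μ μ) {A B K : Set α} (hB : MeasurableSet B)
    (hBA : σ ⁻¹' B = A) (hAB : Disjoint A B) (hK : K =ᵐ[μ] (A ∪ B : Set α)) {G : α → ℝ}
    (hG : IntegrableOn G A μ) (hGσ : IntegrableOn (fun x => G (σ x)) A μ) :
    IntegrableOn G K μ ∧ ∫ x in K, G x ∂μ = ∫ x in A, (G x + G (σ x)) ∂μ := by
  subst hBA
  have hGB : IntegrableOn G B μ :=
    (hσ.integrableOn_comp_preimage σ.measurableEmbedding).1 hGσ
  refine ⟨(hG.union hGB).congr_set_ae hK, ?_⟩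
  rw [setIntegral_congr_set hK, setIntegral_union hAB hB hG hGB, integral_add hG hGσ,
    hσ.setIntegral_preimage_emb σ.measurableEmbedding]

lemma ae_fst_ne_snd : ∀ᵐ x : ℝ × ℝ, x.1 ≠ x.2 := by
  have : volume (LinearMap.ker (LinearMap.fst ℝ ℝ ℝ - LinearMap.snd ℝ ℝ ℝ) : Set (ℝ × ℝ)) = 0 := by
    refine Measure.addHaar_submodule _ _ fun h => ?_
    rw [LinearMap.ker_eq_top] at h
    simpa using LinearMap.congr_fun h (1, 0)
  filter_upwards [compl_mem_ae_iff.2 this] with x hx h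
  exact hx (by simp [h])

lemma ae_fst_ne_neg_snd : ∀ᵐ x : ℝ × ℝ, x.1 ≠ -x.2 := by
  have : volume (LinearMap.ker (LinearMap.fst ℝ ℝ ℝ + LinearMap.snd ℝ ℝ ℝ) : Set (ℝ × ℝ)) = 0 := by
    refine Measure.addHaar_submodule _ _ fun h => ?_
    rw [LinearMap.ker_eq_top] at h
    simpa using LinearMap.congr_fun h (1, 0)
  filter_upwards [compl_mem_ae_iff.2 this] with x hx h
  exact hx (by simp [h])

/-- The part of the square `[-1,1]²` below the diagonal. -/
def lowerTriangle : Set (ℝ × ℝ) := {x | -1 < x.2 ∧ x.2 < x.1 ∧ x.1 < 1}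

/-- The part of the square `[-1,1]²` between the diagonal and the antidiagonal, on the right. -/
def rightSector : Set (ℝ × ℝ) := {x | -x.1 < x.2 ∧ x.2 < x.1 ∧ x.1 < 1}

lemma rightSector_subset : rightSector ⊆ Icc (-1 : ℝ) 1 ×ˢ Icc (-1 : ℝ) 1 := by
  rintro ⟨x, y⟩ ⟨h₁, h₂, h₃⟩
  simp only at h₁ h₂ h₃
  refine ⟨⟨?_, ?_⟩, ?_, ?_⟩ <;> simp only <;> linarith

lemma lowerTriangle_subset : lowerTriangle ⊆ Icc (-1 : ℝ) 1 ×ˢ Icc (-1 : ℝ) 1 := by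
  rintro ⟨x, y⟩ ⟨h₁, h₂, h₃⟩
  simp only at h₁ h₂ h₃
  refine ⟨⟨?_, ?_⟩, ?_, ?_⟩ <;> simp only <;> linarith

lemma integral_square_eq_lowerTriangle {G : ℝ × ℝ → ℝ} (hG : IntegrableOn G lowerTriangle)
    (hG' : IntegrableOn (fun x => G x.swap) lowerTriangle) :
    IntegrableOn G (Icc (-1 : ℝ) 1 ×ˢ Icc (-1 : ℝ) 1) ∧
      ∫ x in Icc (-1 : ℝ) 1 ×ˢ Icc (-1 : ℝ) 1, G x =
        ∫ x in lowerTriangle, (G x + G x.swap) := by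
  refine integral_fold (A := lowerTriangle) (B := {x | -1 < x.1 ∧ x.1 < x.2 ∧ x.2 < 1})
    MeasurableEquiv.prodComm Measure.measurePreserving_swap (by measurability) rfl ?_ ?_ hG hG'
  · rw [Set.disjoint_left]
    rintro x ⟨_, h, _⟩ ⟨_, h', _⟩
    exact h.not_gt h'
  · have hQ : (Icc (-1 : ℝ) 1 ×ˢ Icc (-1 : ℝ) 1 : Set (ℝ × ℝ)) =ᵐ[volume]
        (Ioo (-1 : ℝ) 1 ×ˢ Ioo (-1 : ℝ) 1 : Set (ℝ × ℝ)) :=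
      Measure.set_prod_ae_eq Ioo_ae_eq_Icc.symm Ioo_ae_eq_Icc.symm
    refine hQ.trans (Filter.eventuallyEq_set.2 ?_)
    filter_upwards [ae_fst_ne_snd] with x hx
    simp only [lowerTriangle, mem_prod, mem_Ioo, mem_union, mem_ofPred_eq]
    constructor
    · rintro ⟨⟨_, _⟩, _, _⟩
      rcases hx.lt_or_gt with h | h
      · exact Or.inr ⟨by assumption, h, by assumption⟩
      · exact Or.inl ⟨by assumption, h, by assumption⟩
    · rintro (⟨_, _, _⟩ | ⟨_, _, _⟩) <;> refine ⟨⟨?_, ?_⟩, ?_, ?_⟩ <;> linarith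

lemma integral_lowerTriangle_eq_rightSector {G : ℝ × ℝ → ℝ} (hG : IntegrableOn G rightSector)
    (hG' : IntegrableOn (fun x => G (-x.swap)) rightSector) :
    IntegrableOn G lowerTriangle ∧
      ∫ x in lowerTriangle, G x = ∫ x in rightSector, (G x + G (-x.swap)) := by
  refine integral_fold (B := {x | x.1 < -x.2 ∧ x.2 < x.1 ∧ -1 < x.2})
    (MeasurableEquiv.prodComm.trans (MeasurableEquiv.neg (ℝ × ℝ)))
    ((Measure.measurePreserving_neg volume).comp Measure.measurePreserving_swap)
    (by measurability) ?_ ?_ ?_ hG hG'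
  · ext x
    change -x.2 < - -x.1 ∧ -x.1 < -x.2 ∧ -1 < -x.1 ↔ -x.1 < x.2 ∧ x.2 < x.1 ∧ x.1 < 1
    constructor <;> rintro ⟨_, _, _⟩ <;> refine ⟨?_, ?_, ?_⟩ <;> linarith
  · rw [Set.disjoint_left]
    rintro x ⟨h, _, _⟩ ⟨h', _, _⟩
    linarith
  · refine Filter.eventuallyEq_set.2 ?_
    filter_upwards [ae_fst_ne_neg_snd] with x hx
    simp only [lowerTriangle, rightSector, mem_union, mem_ofPred_eq]
    constructor
    · rintro ⟨_, _, _⟩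
      rcases hx.lt_or_gt with h | h
      · exact Or.inr ⟨by assumption, by assumption, by assumption⟩
      · exact Or.inl ⟨by linarith, by assumption, by assumption⟩
    · rintro (⟨_, _, _⟩ | ⟨_, _, _⟩) <;> refine ⟨?_, ?_, ?_⟩ <;> linarith

/-! ### The change of variables -/

/-- The triangle of angles `0 < a < b < π`. -/
def angleTriangle : Set (ℝ × ℝ) := {p | 0 < p.1 ∧ p.1 < p.2 ∧ p.2 < Real.pi}

lemma measurableSet_angleTriangle : MeasurableSet angleTriangle := by
  unfold angleTriangle
  measurability

/-- The map `(a, b) ↦ (cos a, cos b)`. -/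
def cosMap (p : ℝ × ℝ) : ℝ × ℝ := (Real.cos p.1, Real.cos p.2)

/-- The map `(a, b) ↦ (cos ((b - a) / 2), cos ((b + a) / 2))`. -/
def halfCosMap (p : ℝ × ℝ) : ℝ × ℝ := (Real.cos ((p.2 - p.1) / 2), Real.cos ((p.2 + p.1) / 2))

/-- The derivative of `cosMap`. -/
def fderivCosMap (p : ℝ × ℝ) : ℝ × ℝ →L[ℝ] ℝ × ℝ :=
  (Matrix.toLin (.finTwoProd ℝ) (.finTwoProd ℝ)
    !![-Real.sin p.1, 0; 0, -Real.sin p.2]).toContinuousLinearMap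

/-- The derivative of `halfCosMap`. -/
def fderivHalfCosMap (p : ℝ × ℝ) : ℝ × ℝ →L[ℝ] ℝ × ℝ :=
  (Matrix.toLin (.finTwoProd ℝ) (.finTwoProd ℝ)
    !![Real.sin ((p.2 - p.1) / 2) / 2, -Real.sin ((p.2 - p.1) / 2) / 2;
      -Real.sin ((p.2 + p.1) / 2) / 2, -Real.sin ((p.2 + p.1) / 2) / 2]).toContinuousLinearMap

lemma hasFDerivAt_cosMap (p : ℝ × ℝ) : HasFDerivAt cosMap (fderivCosMap p) p := by
  unfold fderivCosMap
  rw [Matrix.toLin_finTwoProd_toContinuousLinearMap]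
  convert! HasFDerivAt.prodMk (𝕜 := ℝ)
    ((Real.hasDerivAt_cos p.1).comp_hasFDerivAt p hasFDerivAt_fst)
    ((Real.hasDerivAt_cos p.2).comp_hasFDerivAt p hasFDerivAt_snd) using 2 <;>
  · ext <;> simp

lemma hasFDerivAt_halfCosMap (p : ℝ × ℝ) :
    HasFDerivAt halfCosMap (fderivHalfCosMap p) p := by
  unfold fderivHalfCosMap
  rw [Matrix.toLin_finTwoProd_toContinuousLinearMap]
  have h₁ : HasFDerivAt (fun p : ℝ × ℝ => (p.2 - p.1) / 2)
      ((2⁻¹ : ℝ) • (ContinuousLinearMap.snd ℝ ℝ ℝ - ContinuousLinearMap.fst ℝ ℝ ℝ)) p := by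
    simpa only [div_eq_mul_inv] using (hasFDerivAt_snd.fun_sub hasFDerivAt_fst).mul_const (2⁻¹ : ℝ)
  have h₂ : HasFDerivAt (fun p : ℝ × ℝ => (p.2 + p.1) / 2)
      ((2⁻¹ : ℝ) • (ContinuousLinearMap.snd ℝ ℝ ℝ + ContinuousLinearMap.fst ℝ ℝ ℝ)) p := by
    simpa only [div_eq_mul_inv] using (hasFDerivAt_snd.fun_add hasFDerivAt_fst).mul_const (2⁻¹ : ℝ)
  convert! HasFDerivAt.prodMk (𝕜 := ℝ)
    ((Real.hasDerivAt_cos _).comp_hasFDerivAt p h₁)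
    ((Real.hasDerivAt_cos _).comp_hasFDerivAt p h₂) using 2 <;>
  · ext <;> simp <;> ring

lemma det_fderivCosMap (p : ℝ × ℝ) :
    (fderivCosMap p).det = Real.sin p.1 * Real.sin p.2 := by
  unfold fderivCosMap
  simp only [LinearMap.det_toContinuousLinearMap, LinearMap.det_toLin, Matrix.det_fin_two_of]
  ring

lemma det_fderivHalfCosMap (p : ℝ × ℝ) : (fderivHalfCosMap p).det =
    -(Real.sin ((p.2 - p.1) / 2) * Real.sin ((p.2 + p.1) / 2) / 2) := by
  unfold fderivHalfCosMap
  simp only [LinearMap.det_toContinuousLinearMap, LinearMap.det_toLin, Matrix.det_fin_two_of]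
  ring

lemma injOn_cosMap : InjOn cosMap angleTriangle := by
  rintro ⟨a, b⟩ ⟨h₁, h₂, h₃⟩ ⟨a', b'⟩ ⟨h₁', h₂', h₃'⟩ h
  simp only [cosMap, Prod.mk.injEq] at *
  exact ⟨Real.injOn_cos ⟨by linarith, by linarith⟩ ⟨by linarith, by linarith⟩ h.1,
    Real.injOn_cos ⟨by linarith, by linarith⟩ ⟨by linarith, by linarith⟩ h.2⟩

lemma injOn_halfCosMap : InjOn halfCosMap angleTriangle := by
  rintro ⟨a, b⟩ ⟨h₁, h₂, h₃⟩ ⟨a', b'⟩ ⟨h₁', h₂', h₃'⟩ h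
  simp only [halfCosMap, Prod.mk.injEq] at *
  have h₄ := Real.injOn_cos ⟨by linarith, by linarith⟩ ⟨by linarith, by linarith⟩ h.1
  have h₅ := Real.injOn_cos ⟨by linarith, by linarith⟩ ⟨by linarith, by linarith⟩ h.2
  constructor <;> linarith

lemma image_cosMap : cosMap '' angleTriangle = lowerTriangle := by
  ext ⟨x, y⟩
  constructor
  · rintro ⟨⟨a, b⟩, ⟨h₁, h₂, h₃⟩, h⟩
    simp only [cosMap, Prod.mk.injEq] at *
    obtain ⟨rfl, rfl⟩ := h
    refine ⟨?_, ?_, ?_⟩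
    · simpa using Real.cos_lt_cos_of_nonneg_of_le_pi (by linarith) le_rfl h₃
    · exact Real.cos_lt_cos_of_nonneg_of_le_pi h₁.le h₃.le h₂
    · simpa using Real.cos_lt_cos_of_nonneg_of_le_pi le_rfl (by linarith) h₁
  · rintro ⟨h₁, h₂, h₃⟩
    simp only at h₁ h₂ h₃
    refine ⟨(Real.arccos x, Real.arccos y), ⟨Real.arccos_pos.2 h₃,
      Real.strictAntiOn_arccos ⟨by linarith, by linarith⟩ ⟨by linarith, by linarith⟩ h₂, ?_⟩, ?_⟩
    · simpa using Real.strictAntiOn_arccos ⟨le_rfl, by linarith⟩ ⟨by linarith, by linarith⟩ h₁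
    · simp only [cosMap]
      rw [Real.cos_arccos (by linarith) (by linarith), Real.cos_arccos (by linarith) (by linarith)]

lemma image_halfCosMap : halfCosMap '' angleTriangle = rightSector := by
  ext ⟨x, y⟩
  constructor
  · rintro ⟨⟨a, b⟩, ⟨h₁, h₂, h₃⟩, h⟩
    simp only [halfCosMap, Prod.mk.injEq] at *
    obtain ⟨rfl, rfl⟩ := h
    refine ⟨?_, ?_, ?_⟩
    · simp only
      rw [← Real.cos_pi_sub]
      exact Real.cos_lt_cos_of_nonneg_of_le_pi (by linarith) (by linarith) (by linarith)
    · exact Real.cos_lt_cos_of_nonneg_of_le_pi (by linarith) (by linarith) (by linarith)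
    · simpa using Real.cos_lt_cos_of_nonneg_of_le_pi (y := (b - a) / 2) le_rfl
        (by linarith) (by linarith)
  · rintro ⟨h₁, h₂, h₃⟩
    simp only at h₁ h₂ h₃
    have h₄ := Real.arccos_pos.2 h₃
    have h₅ := Real.strictAntiOn_arccos ⟨by linarith, by linarith⟩ ⟨by linarith, by linarith⟩ h₂
    have h₆ := Real.strictAntiOn_arccos ⟨by linarith, by linarith⟩ ⟨by linarith, by linarith⟩
      (show -y < x by linarith)
    rw [Real.arccos_neg] at h₆
    refine ⟨(Real.arccos y - Real.arccos x, Real.arccos y + Real.arccos x),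
      ⟨?_, ?_, ?_⟩, ?_⟩
    · simp only; linarith
    · simp only; linarith
    · simp only; linarith
    · simp only [halfCosMap]
      rw [show ∀ u v : ℝ, (u + v - (u - v)) / 2 = v by intros; ring,
        show ∀ u v : ℝ, (u + v + (u - v)) / 2 = u by intros; ring,
        Real.cos_arccos (by linarith) (by linarith), Real.cos_arccos (by linarith) (by linarith)]

lemma two_mul_cos_half_mul_cos_half (a b : ℝ) :
    2 * (Real.cos ((b - a) / 2) * Real.cos ((b + a) / 2)) = Real.cos a + Real.cos b := by
  rw [Real.cos_add_cos, ← neg_sub b a, neg_div, Real.cos_neg, add_comm b a]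
  ring

lemma cos_half_sq_sub_cos_half_sq (a b : ℝ) :
    Real.cos ((b - a) / 2) ^ 2 - Real.cos ((b + a) / 2) ^ 2 = Real.sin a * Real.sin b := by
  rw [Real.cos_sq, Real.cos_sq, mul_div_cancel₀ _ two_ne_zero, mul_div_cancel₀ _ two_ne_zero,
    Real.cos_sub, Real.cos_add]
  ring

lemma cos_half_sq_add_cos_half_sq (a b : ℝ) :
    Real.cos ((b - a) / 2) ^ 2 + Real.cos ((b + a) / 2) ^ 2 - 1 = Real.cos a * Real.cos b := by
  rw [Real.cos_sq, Real.cos_sq, mul_div_cancel₀ _ two_ne_zero, mul_div_cancel₀ _ two_ne_zero,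
    Real.cos_sub, Real.cos_add]
  ring

lemma Wm_halfCosMap (w : ℝ → ℝ) {p : ℝ × ℝ} (hp : p ∈ angleTriangle) :
    |(fderivHalfCosMap p).det| * Wm w (halfCosMap p) =
      1 / 2 * (|(fderivCosMap p).det| * (w (cosMap p).1 * w (cosMap p).2)) := by
  obtain ⟨a, b⟩ := p
  obtain ⟨h₁, h₂, h₃⟩ := hp
  simp only at h₁ h₂ h₃
  have hs₁ : 0 < Real.sin ((b - a) / 2) :=
    Real.sin_pos_of_pos_of_lt_pi (by linarith) (by linarith)
  have hs₂ : 0 < Real.sin ((b + a) / 2) :=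
    Real.sin_pos_of_pos_of_lt_pi (by linarith) (by linarith)
  simp only [det_fderivHalfCosMap, det_fderivCosMap, Wm, halfCosMap, cosMap]
  rw [Real.arccos_cos (by linarith) (by linarith), Real.arccos_cos (by linarith) (by linarith),
    cos_half_sq_sub_cos_half_sq, ← Real.abs_sin_eq_sqrt_one_sub_cos_sq,
    ← Real.abs_sin_eq_sqrt_one_sub_cos_sq, abs_neg, abs_of_pos (by positivity), abs_of_pos hs₁,
    abs_of_pos hs₂, show (b - a) / 2 - (b + a) / 2 = -a by ring, Real.cos_neg,
    show (b - a) / 2 + (b + a) / 2 = b by ring]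
  field_simp

lemma integrableOn_rightSector_iff (w : ℝ → ℝ) {F P : ℝ × ℝ → ℝ}
    (h : ∀ p ∈ angleTriangle, F (halfCosMap p) = P (cosMap p)) :
    IntegrableOn (fun x => F x * Wm w x) rightSector ↔
      IntegrableOn (fun z => P z * (w z.1 * w z.2)) lowerTriangle := by
  rw [← image_halfCosMap, ← image_cosMap,
    integrableOn_image_iff_integrableOn_abs_det_fderiv_smul _ measurableSet_angleTriangle
      (fun p _ => (hasFDerivAt_halfCosMap p).hasFDerivWithinAt) injOn_halfCosMap,
    integrableOn_image_iff_integrableOn_abs_det_fderiv_smul _ measurableSet_angleTriangle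
      (fun p _ => (hasFDerivAt_cosMap p).hasFDerivWithinAt) injOn_cosMap]
  refine Iff.trans ?_ (integrable_const_mul_iff (c := (1 / 2 : ℝ)) (by norm_num) _)
  refine integrableOn_congr_fun (fun p hp => ?_) measurableSet_angleTriangle
  simp only [smul_eq_mul]
  rw [mul_left_comm, Wm_halfCosMap w hp, h p hp]
  ring

lemma integral_rightSector_eq (w : ℝ → ℝ) {F P : ℝ × ℝ → ℝ}
    (h : ∀ p ∈ angleTriangle, F (halfCosMap p) = P (cosMap p)) :
    ∫ x in rightSector, F x * Wm w x =
      1 / 2 * ∫ z in lowerTriangle, P z * (w z.1 * w z.2) := by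
  rw [← image_halfCosMap, ← image_cosMap,
    integral_image_eq_integral_abs_det_fderiv_smul _ measurableSet_angleTriangle
      (fun p _ => (hasFDerivAt_halfCosMap p).hasFDerivWithinAt) injOn_halfCosMap,
    integral_image_eq_integral_abs_det_fderiv_smul _ measurableSet_angleTriangle
      (fun p _ => (hasFDerivAt_cosMap p).hasFDerivWithinAt) injOn_cosMap,
    ← integral_const_mul]
  refine setIntegral_congr_fun measurableSet_angleTriangle fun p hp => ?_
  simp only [smul_eq_mul]
  rw [mul_left_comm, Wm_halfCosMap w hp, h p hp]
  ring

/-! ### The product Gauss rule -/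

lemma Wm_swap (w : ℝ → ℝ) (x : ℝ × ℝ) : Wm w x.swap = Wm w x := by
  simp only [Wm, Prod.fst_swap, Prod.snd_swap]
  rw [← Real.cos_neg, neg_sub, add_comm, abs_sub_comm, mul_comm (√(1 - x.2 ^ 2))]

lemma Wm_neg_swap (w : ℝ → ℝ) (x : ℝ × ℝ) : Wm w (-x.swap) = Wm w x := by
  simp only [Wm, Prod.fst_neg, Prod.snd_neg, Prod.fst_swap, Prod.snd_swap, Real.arccos_neg,
    neg_sq]
  rw [show ∀ a b : ℝ, Real.pi - a - (Real.pi - b) = b - a by intros; ring,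
    show ∀ a b : ℝ, Real.pi - a + (Real.pi - b) = 2 * Real.pi - (b + a) by intros; ring,
    Real.cos_two_pi_sub, abs_sub_comm, mul_comm (√(1 - x.2 ^ 2))]

lemma integrableOn_mul_square {w : ℝ → ℝ} (hw : IntegrableOn w (Icc (-1 : ℝ) 1)) :
    IntegrableOn (fun z : ℝ × ℝ => w z.1 * w z.2) (Icc (-1 : ℝ) 1 ×ˢ Icc (-1 : ℝ) 1) := by
  rw [IntegrableOn, Measure.volume_eq_prod, ← Measure.prod_restrict]
  exact hw.mul_prod hw

lemma integrableOn_Wm {w : ℝ → ℝ} (hw : IntegrableOn w (Icc (-1 : ℝ) 1)) :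
    IntegrableOn (Wm w) (Icc (-1 : ℝ) 1 ×ˢ Icc (-1 : ℝ) 1) := by
  have hS : IntegrableOn (Wm w) rightSector := by
    simpa using (integrableOn_rightSector_iff w (F := 1) (P := 1) fun _ _ => rfl).2
      (by simpa using (integrableOn_mul_square hw).mono_set lowerTriangle_subset)
  have hL := (integral_lowerTriangle_eq_rightSector hS (by simpa only [Wm_neg_swap])).1
  exact (integral_square_eq_lowerTriangle hL (by simpa only [Wm_swap])).1

lemma integral_mul_Wm {w : ℝ → ℝ} (hw : IntegrableOn w (Icc (-1 : ℝ) 1)) {f P : ℝ → ℝ → ℝ}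
    (hf : Continuous fun x : ℝ × ℝ => f x.1 x.2) (hP : Continuous fun x : ℝ × ℝ => P x.1 x.2)
    (hsymm : ∀ x y, P x y = P y x)
    (h : ∀ x₁ x₂ x y : ℝ, x + y = 2 * (x₁ * x₂) → x * y = x₁ ^ 2 + x₂ ^ 2 - 1 →
      P x y = orbitSum f x₁ x₂) :
    ∫ x in Icc (-1 : ℝ) 1 ×ˢ Icc (-1 : ℝ) 1, f x.1 x.2 * Wm w x =
      1 / 4 * ∫ z in Icc (-1 : ℝ) 1 ×ˢ Icc (-1 : ℝ) 1, P z.1 z.2 * (w z.1 * w z.2) := by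
  have hcomp : IsCompact (Icc (-1 : ℝ) 1 ×ˢ Icc (-1 : ℝ) 1) := isCompact_Icc.prod isCompact_Icc
  have hint {g : ℝ × ℝ → ℝ} (hg : Continuous g) :
      IntegrableOn (fun x => g x * Wm w x) (Icc (-1 : ℝ) 1 ×ˢ Icc (-1 : ℝ) 1) :=
    (integrableOn_Wm hw).continuousOn_mul hg.continuousOn hcomp
  have hswap : Continuous fun x : ℝ × ℝ => f x.2 x.1 := hf.comp continuous_swap
  have hadd : Continuous fun x : ℝ × ℝ => f x.1 x.2 + f x.2 x.1 := hf.add hswap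
  have hneg : Continuous fun x : ℝ × ℝ => f (-x.1) (-x.2) := hf.comp continuous_neg
  have hadd_neg : Continuous fun x : ℝ × ℝ => f (-x.2) (-x.1) + f (-x.1) (-x.2) :=
    (hneg.comp continuous_swap).add hneg
  have hleft : ∫ x in Icc (-1 : ℝ) 1 ×ˢ Icc (-1 : ℝ) 1, f x.1 x.2 * Wm w x =
      ∫ x in rightSector, orbitSum f x.1 x.2 * Wm w x := by
    rw [(integral_square_eq_lowerTriangle ((hint hf).mono_set lowerTriangle_subset) (by
      simpa only [Wm_swap, Prod.fst_swap, Prod.snd_swap] using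
        (hint hswap).mono_set lowerTriangle_subset)).2]
    simp only [Wm_swap, Prod.fst_swap, Prod.snd_swap, ← add_mul]
    rw [(integral_lowerTriangle_eq_rightSector
      ((hint hadd).mono_set rightSector_subset) (by
      simpa only [Wm_neg_swap, Prod.fst_neg, Prod.snd_neg, Prod.fst_swap, Prod.snd_swap] using
        (hint hadd_neg).mono_set rightSector_subset)).2]
    simp only [Wm_neg_swap, Prod.fst_neg, Prod.snd_neg, Prod.fst_swap, Prod.snd_swap, ← add_mul,
      orbitSum]
    congr with x
    ring
  have hPint := (integrableOn_mul_square hw).continuousOn_mul hP.continuousOn hcomp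
  have hright : ∫ z in Icc (-1 : ℝ) 1 ×ˢ Icc (-1 : ℝ) 1, P z.1 z.2 * (w z.1 * w z.2) =
      2 * ∫ z in lowerTriangle, P z.1 z.2 * (w z.1 * w z.2) := by
    have heq (z : ℝ × ℝ) : P z.swap.1 z.swap.2 * (w z.swap.1 * w z.swap.2) =
        P z.1 z.2 * (w z.1 * w z.2) := by
      rw [Prod.fst_swap, Prod.snd_swap, hsymm, mul_comm (w z.2)]
    rw [(integral_square_eq_lowerTriangle (hPint.mono_set lowerTriangle_subset) (by
      simpa only [heq] using hPint.mono_set lowerTriangle_subset)).2]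
    simp only [heq, ← two_mul, integral_const_mul]
  rw [hleft, hright, integral_rightSector_eq w (F := fun x => orbitSum f x.1 x.2)
    (P := fun z => P z.1 z.2)]
  · ring
  · intro p _
    exact (h _ _ _ _ (two_mul_cos_half_mul_cos_half _ _).symm
      (cos_half_sq_add_cos_half_sq _ _).symm).symm

open MvPolynomial in
lemma integral_prod_gauss {w : ℝ → ℝ} (hw : IntegrableOn w (Icc (-1 : ℝ) 1)) {n : ℕ}
    {ι : Type*} [Fintype ι] {t lam : ι → ℝ}
    (hquad : ∀ g : Polynomial ℝ, g.natDegree ≤ n →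
      (∫ u in Icc (-1 : ℝ) 1, g.eval u * w u) = ∑ k, lam k * g.eval (t k))
    {P : MvPolynomial (Fin 2) ℝ} (hP : ∀ i, P.degreeOf i ≤ n) :
    ∫ z in Icc (-1 : ℝ) 1 ×ˢ Icc (-1 : ℝ) 1, eval ![z.1, z.2] P * (w z.1 * w z.2) =
      ∑ j, ∑ k, lam j * lam k * eval ![t j, t k] P := by
  have hmoment {k : ℕ} (hk : k ≤ n) :
      ∫ u in Icc (-1 : ℝ) 1, u ^ k * w u = ∑ i, lam i * t i ^ k := by
    simpa using hquad (Polynomial.X ^ k) (by simpa using hk)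
  have hint (k : ℕ) : IntegrableOn (fun u => u ^ k * w u) (Icc (-1 : ℝ) 1) :=
    hw.continuousOn_mul (by fun_prop) isCompact_Icc
  have hexpand (x y a b : ℝ) : eval ![x, y] P * (a * b) =
      ∑ d ∈ P.support, P.coeff d * ((x ^ d 0 * a) * (y ^ d 1 * b)) := by
    rw [eval_eq', Finset.sum_mul]
    refine Finset.sum_congr rfl fun d _ => ?_
    simp only [Fin.prod_univ_two, Matrix.cons_val_zero, Matrix.cons_val_one]
    ring
  simp only [hexpand]
  rw [Measure.volume_eq_prod, ← Measure.prod_restrict, integral_finsetSum _ fun d _ =>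
    ((hint (d 0)).mul_prod (hint (d 1))).const_mul _]
  have hterm (d : Fin 2 →₀ ℕ) (hd : d ∈ P.support) :
      ∫ z : ℝ × ℝ, P.coeff d * ((z.1 ^ d 0 * w z.1) * (z.2 ^ d 1 * w z.2))
        ∂(volume.restrict (Icc (-1 : ℝ) 1)).prod (volume.restrict (Icc (-1 : ℝ) 1)) =
      ∑ j, ∑ k, lam j * lam k * (P.coeff d * (t j ^ d 0 * t k ^ d 1)) := by
    rw [integral_const_mul, integral_prod_mul (fun u => u ^ d 0 * w u) fun u => u ^ d 1 * w u,
      hmoment ((monomial_le_degreeOf 0 hd).trans (hP 0)),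
      hmoment ((monomial_le_degreeOf 1 hd).trans (hP 1)), Finset.sum_mul_sum, Finset.mul_sum]
    refine Finset.sum_congr rfl fun j _ => ?_
    rw [Finset.mul_sum]
    exact Finset.sum_congr rfl fun k _ => by ring
  rw [Finset.sum_congr rfl hterm, Finset.sum_comm]
  refine Finset.sum_congr rfl fun j _ => ?_
  rw [Finset.sum_comm]
  refine Finset.sum_congr rfl fun k _ => ?_
  simp only [eval_eq', Fin.prod_univ_two, Matrix.cons_val_zero, Matrix.cons_val_one,
    Finset.mul_sum]

lemma sum_Iic_half_diagonal {ι : Type*} [Fintype ι] [LinearOrder ι] [LocallyFiniteOrderBot ι]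
    {a : ι → ι → ℝ} (ha : ∀ j k, a j k = a k j) :
    ∑ k, ∑ j ∈ Finset.Iic k, (if j = k then (1 : ℝ) / 2 else 1) * a j k =
      1 / 2 * ∑ j, ∑ k, a j k := by
  have hIic (k : ι) : ∑ j ∈ Finset.Iic k, (if j = k then (1 : ℝ) / 2 else 1) * a j k =
      ∑ j, if j ≤ k then (if j = k then (1 : ℝ) / 2 else 1) * a j k else 0 := by
    rw [← Finset.sum_filter]
    congr 1
    ext j
    simp
  simp only [hIic]
  have hdouble (S : ι → ι → ℝ) : ∑ k, ∑ j, S j k = 1 / 2 * ∑ j, ∑ k, (S j k + S k j) := by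
    simp only [Finset.sum_add_distrib]
    rw [Finset.sum_comm (f := fun j k => S j k)]
    ring
  rw [hdouble]
  congr! 3 with j _ k _
  rcases lt_trichotomy j k with h | rfl | h
  · simp [h.le, h.ne, h.not_ge]
  · simp
    ring
  · simp [h.le, h.ne, h.not_ge, ha j k]

/-! ### The nodes -/

/-- The four images of a point under the group generated by the reflections in the diagonals. -/
def orbitPoint (x y : ℝ) : Fin 4 → ℝ × ℝ := ![(x, y), (y, x), (-x, -y), (-y, -x)]

lemma orbitPoint_inj {x y x' y' : ℝ} (h₁ : y < x) (h₂ : -x < y) (h₁' : y' < x') (h₂' : -x' < y')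
    {i i' : Fin 4} (h : orbitPoint x y i = orbitPoint x' y' i') : (x = x' ∧ y = y') ∧ i = i' := by
  fin_cases i <;> fin_cases i' <;> simp [orbitPoint] at h ⊢ <;>
    first | exact h | exact h.symm | exfalso; linarith

lemma eq_of_add_eq_of_mul_eq {ι : Type*} [LinearOrder ι] {t : ι → ℝ} (ht : Function.Injective t)
    {j k j' k' : ι} (hjk : j ≤ k) (hjk' : j' ≤ k') (hadd : t j + t k = t j' + t k')
    (hmul : t j * t k = t j' * t k') : j = j' ∧ k = k' := by
  have : (t j - t j') * (t j - t k') = 0 := by linear_combination t j * hadd - hmul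
  rcases mul_eq_zero.1 this with h | h
  · exact ⟨ht (by linarith), ht (by linarith)⟩
  · have h₁ : j = k' := ht (by linarith)
    have h₂ : k = j' := ht (by linarith)
    subst h₁ h₂
    exact ⟨hjk.antisymm hjk', hjk'.antisymm hjk⟩

lemma card_sigma_Iic (m : ℕ) :
    ((Finset.univ : Finset (Fin m)).sigma fun k => Finset.Iic k).card * 2 = m * (m + 1) := by
  rw [Finset.card_sigma]
  simp only [Fin.card_Iic]
  have h := Finset.sum_range_id_mul_two (m + 1)
  rw [Finset.sum_range_succ', add_zero, Nat.add_sub_cancel] at h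
  rw [Fin.sum_univ_eq_sum_range (fun i => i + 1), h, mul_comm]

theorem stmt12 (w : ℝ → ℝ)
    (hw_nonneg : ∀ t ∈ Icc (-1:ℝ) 1, 0 ≤ w t)
    (hw_int : IntegrableOn w (Icc (-1:ℝ) 1))
    (hw_ne : ¬ (w =ᵐ[volume.restrict (Icc (-1:ℝ) 1)] 0))
    (m : ℕ) (hm : 1 ≤ m)
    (t : Fin m → ℝ) (lam : Fin m → ℝ)
    (ht : ∀ k, t k ∈ Ioo (-1:ℝ) 1) (htinj : Function.Injective t)
    (hlam : ∀ k, 0 < lam k)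
    (hquad : ∀ g : Polynomial ℝ, g.natDegree ≤ 2*m - 1 →
      (∫ u in Icc (-1:ℝ) 1, g.eval u * w u) = ∑ k, lam k * g.eval (t k))
    (θ : Fin m → ℝ) (hθ : ∀ k, θ k = Real.arccos (t k))
    (s τ : Fin m → Fin m → ℝ)
    (hs : ∀ j k, s j k = Real.cos ((θ j - θ k) / 2))
    (hτ : ∀ j k, τ j k = Real.cos ((θ j + θ k) / 2)) :
    -- the minimal cubature rule of degree 4m−1 for W_{-1/2}
    (∀ f : MvPolynomial (Fin 2) ℝ, f.totalDegree ≤ 4*m - 1 →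
      (∫ x in (Icc (-1:ℝ) 1) ×ˢ (Icc (-1:ℝ) 1),
        MvPolynomial.eval ![x.1, x.2] f * Wm w x) =
      (1/2) * ∑ k, ∑ j ∈ Finset.Iic k,
        (if j = k then (1:ℝ)/2 else 1) * (lam j * lam k *
          (MvPolynomial.eval ![s j k, τ j k] f + MvPolynomial.eval ![τ j k, s j k] f +
           MvPolynomial.eval ![-s j k, -τ j k] f + MvPolynomial.eval ![-τ j k, -s j k] f))) ∧
    -- the nodes are 2m(m+1) distinct points, attaining Möller's lower bound
    (let X : Set (ℝ × ℝ) := {z | ∃ j k : Fin m, j ≤ k ∧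
        (z = (s j k, τ j k) ∨ z = (τ j k, s j k) ∨
         z = (-s j k, -τ j k) ∨ z = (-τ j k, -s j k))};
      X.Finite ∧ X.ncard = 2 * m * (m + 1)) := by
  have hθpos (k) : 0 < θ k := by rw [hθ]; exact Real.arccos_pos.2 (ht k).2
  have hθlt (k) : θ k < Real.pi := by
    rw [hθ, Real.arccos_lt_pi]
    exact (ht k).1
  have hcos (k) : Real.cos (θ k) = t k := by
    rw [hθ, Real.cos_arccos (ht k).1.le (ht k).2.le]
  have hτs (j k) : τ j k < s j k := by
    rw [hs, hτ, ← Real.cos_abs ((θ j - θ k) / 2)]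
    refine Real.cos_lt_cos_of_nonneg_of_le_pi (abs_nonneg _) ?_ (abs_lt.2 ⟨?_, ?_⟩) <;>
      linarith [hθpos j, hθpos k, hθlt j, hθlt k]
  have hsτ (j k) : -s j k < τ j k := by
    rw [hs, hτ, ← Real.cos_abs ((θ j - θ k) / 2), ← Real.cos_pi_sub]
    have hle : |(θ j - θ k) / 2| ≤ Real.pi / 2 :=
      abs_le.2 ⟨by linarith [hθpos j, hθlt k], by linarith [hθpos k, hθlt j]⟩
    refine Real.cos_lt_cos_of_nonneg_of_le_pi ?_ (by linarith [abs_nonneg ((θ j - θ k) / 2)]) ?_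
    · linarith [hθpos j, hθpos k]
    · rw [lt_sub_comm]
      exact abs_lt.2 ⟨by linarith [hθlt j, hθlt k], by linarith [hθlt j, hθlt k]⟩
  have hadd (j k) : t j + t k = 2 * (s j k * τ j k) := by
    rw [hs, hτ, two_mul_cos_half_mul_cos_half (θ k) (θ j), hcos, hcos, add_comm]
  have hmul (j k) : t j * t k = s j k ^ 2 + τ j k ^ 2 - 1 := by
    rw [hs, hτ, cos_half_sq_add_cos_half_sq (θ k) (θ j), hcos, hcos, mul_comm]
  refine ⟨fun f hf => ?_, ?_⟩
  · obtain ⟨P, hP, hPf⟩ := exists_isSymmLE_orbitSum f (n := 2 * m - 1) (by omega)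
    have hcont (Q : MvPolynomial (Fin 2) ℝ) :
        Continuous fun x : ℝ × ℝ => MvPolynomial.eval ![x.1, x.2] Q :=
      (MvPolynomial.continuous_eval Q).comp (by fun_prop)
    have hsymm (j k) : lam j * lam k * MvPolynomial.eval ![t j, t k] P =
        lam k * lam j * MvPolynomial.eval ![t k, t j] P := by
      rw [hP.2, mul_comm (lam j)]
    have hnode (j k) : MvPolynomial.eval ![s j k, τ j k] f + MvPolynomial.eval ![τ j k, s j k] f +
        MvPolynomial.eval ![-s j k, -τ j k] f + MvPolynomial.eval ![-τ j k, -s j k] f =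
        MvPolynomial.eval ![t j, t k] P :=
      (hPf _ _ _ _ (hadd j k) (hmul j k)).symm
    simp only [hnode]
    rw [integral_mul_Wm hw_int (f := fun x y => MvPolynomial.eval ![x, y] f)
      (P := fun x y => MvPolynomial.eval ![x, y] P) (hcont f) (hcont P) hP.2 hPf,
      integral_prod_gauss hw_int hquad hP.1, sum_Iic_half_diagonal hsymm]
    ring
  · intro X
    set N := ((Finset.univ : Finset (Fin m)).sigma fun k => Finset.Iic k) ×ˢ
      (Finset.univ : Finset (Fin 4)) with hN
    let Φ : (Σ _ : Fin m, Fin m) × Fin 4 → ℝ × ℝ := fun q =>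
      orbitPoint (s q.1.2 q.1.1) (τ q.1.2 q.1.1) q.2
    have hX : X = (N.image Φ : Finset (ℝ × ℝ)) := by
      ext z
      simp only [X, N, Φ, orbitPoint, mem_ofPred_eq, Finset.coe_image, Set.mem_image,
        Finset.mem_coe, Finset.mem_product, Finset.mem_sigma, Finset.mem_univ, Finset.mem_Iic,
        true_and, and_true, Prod.exists, Sigma.exists, Fin.exists_fin_succ]
      constructor
      · rintro ⟨j, k, hjk, h⟩
        refine ⟨k, j, ?_⟩
        simpa [hjk, eq_comm] using h
      · rintro ⟨k, j, h⟩
        refine ⟨j, k, ?_⟩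
        simpa [eq_comm, and_or_left] using h
    have hΦ : Set.InjOn Φ N := by
      rintro ⟨⟨k, j⟩, i⟩ hq ⟨⟨k', j'⟩, i'⟩ hq' h
      simp only [N, Finset.coe_product, Set.mem_prod, Finset.mem_coe, Finset.mem_sigma,
        Finset.mem_univ, Finset.mem_Iic, true_and, and_true] at hq hq'
      obtain ⟨⟨h₁, h₂⟩, rfl⟩ := orbitPoint_inj (hτs _ _) (hsτ _ _) (hτs _ _) (hsτ _ _) h
      simp only at h₁ h₂
      obtain ⟨rfl, rfl⟩ := eq_of_add_eq_of_mul_eq htinj hq hq'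
        (by rw [hadd, hadd, h₁, h₂]) (by rw [hmul, hmul, h₁, h₂])
      rfl
    refine ⟨hX ▸ Finset.finite_toSet _, ?_⟩
    rw [hX, Set.ncard_coe_finset, Finset.card_image_of_injOn hΦ, hN, Finset.card_product,
      Finset.card_univ, Fintype.card_fin]
    linarith [card_sigma_Iic m]

end
end
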